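/- Under the stated hypotheses, the Orbit 2 (L,K,K) three-term relation holds: A(1−a, e−a, f−a, g−a)·B_4(b,a,c,d,e,f,g)·K(a;b,c,d;e,f,g) − A(1−b, e−b, f−b, g−b)·B_4(a,b,c,d,e,f,g)·K(b;a,c,d;e,f,g) − S(b−a)·A(f−a, f−b, f−c, f−d)·A(g−a, g−b, g−c, g−d)·A(a,b,c,d)·L(1−a, 1−b, 1−c, 1−d; 2−e; 2−f, 2−g) = 0. Here B_4(b,a,c,d,e,f,g) denotes B_4 evaluated with its first two arguments interchanged, i.e. π^{−4}·S(f−b,g−b)·(S(a,c,d) + S(e−b,f,g)). -/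

import Mathlib

noncomputable section

open Complex

/-- `Sn x = sin (π x)`. -/
def Sn (x : ℂ) : ℂ := Complex.sin ((Real.pi : ℂ) * x)

/-- The renormalized Saalschützian series
`F*(a,b,c,d;e,f,g) = ∑ₖ Γ(k+a)Γ(k+b)Γ(k+c)Γ(k+d)/(k!·Γ(k+e)Γ(k+f)Γ(k+g))`. -/
def Fstar (a b c d e f g : ℂ) : ℂ :=
  ∑' k : ℕ, (Complex.Gamma (k + a) * Complex.Gamma (k + b) *
      Complex.Gamma (k + c) * Complex.Gamma (k + d)) /
    ((k.factorial : ℂ) * Complex.Gamma (k + e) * Complex.Gamma (k + f) *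
      Complex.Gamma (k + g))

/-- The function `K(a;b,c,d;e,f,g)`. -/
def Kf (a b c d e f g : ℂ) : ℂ :=
  (Fstar a b c d e f g +
      Fstar a (1 + a - e) (1 + a - f) (1 + a - g) (1 + a - b) (1 + a - c) (1 + a - d)) /
    (Sn a * Complex.Gamma a ^ 2 * Complex.Gamma b * Complex.Gamma c * Complex.Gamma d *
      Complex.Gamma (1 + a - e) * Complex.Gamma (1 + a - f) * Complex.Gamma (1 + a - g))

/-- The function `L(a,b,c,d;e;f,g)`. -/
def Lf (a b c d e f g : ℂ) : ℂ :=
  (Fstar a b c d e f g -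
      Fstar (1 + a - e) (1 + b - e) (1 + c - e) (1 + d - e) (2 - e) (1 + f - e) (1 + g - e)) /
    (Sn e * Complex.Gamma a * Complex.Gamma b * Complex.Gamma c * Complex.Gamma d *
      Complex.Gamma (1 + a - e) * Complex.Gamma (1 + b - e) * Complex.Gamma (1 + c - e) *
      Complex.Gamma (1 + d - e))

/-- `A(x,y,z,t) = 1/(Γ(x)Γ(y)Γ(z)Γ(t))`. -/
def Af (x y z t : ℂ) : ℂ :=
  1 / (Complex.Gamma x * Complex.Gamma y * Complex.Gamma z * Complex.Gamma t)

def B1 (a b c d e f g : ℂ) : ℂ :=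
  Sn b * Sn c * (Sn (b - a) * Sn (c - a) * Sn d + Sn (e - a) * Sn (f - a) * Sn (g - a)) /
    (Real.pi : ℂ) ^ 4

def B2 (a b c d e f g : ℂ) : ℂ :=
  Sn (f - a) * Sn (g - a) *
    (Sn (b - a) * Sn (c - a) * Sn (d - a) + Sn (e - 2 * a) * Sn (f - a) * Sn (g - a)) /
    (Real.pi : ℂ) ^ 4

def B3 (a b c d e f g : ℂ) : ℂ :=
  (Sn f * Sn (f - e) * Sn (g - a) * Sn (g - b) * Sn (g - c) * Sn (g - d) -
      Sn g * Sn (g - e) * Sn (f - a) * Sn (f - b) * Sn (f - c) * Sn (f - d)) /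
    ((Real.pi : ℂ) ^ 4 * Sn (f - g))

def B4 (a b c d e f g : ℂ) : ℂ :=
  Sn (f - a) * Sn (g - a) * (Sn b * Sn c * Sn d + Sn (e - a) * Sn f * Sn g) /
    (Real.pi : ℂ) ^ 4

def B5 (a b c d e f g : ℂ) : ℂ :=
  Sn b * Sn (e - b) *
    (Sn (b - a) * Sn (c - a) * Sn (d - a) + Sn (e - 2 * a) * Sn (f - a) * Sn (g - a)) /
    (Real.pi : ℂ) ^ 4

def Cf (a b c d e f g : ℂ) : ℂ :=
  Sn (e - a) * (Sn b * Sn c * Sn d * B2 a b c d e f g +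
      Sn e * Sn (f - a) * Sn (g - a) * B4 a b c d e f g) / (Real.pi : ℂ) ^ 4

open Filter Topology Asymptotics

theorem Gamma_add_natCast_eq_prod (x : ℂ) (hx : ∀ m : ℕ, x ≠ -m) (n : ℕ) :
    Gamma (x + n) = Gamma x * ∏ j ∈ Finset.range n, (x + j) := by
  induction n with
  | zero => simp
  | succ n ih =>
    have h : x + n ≠ 0 := fun h => hx n (eq_neg_of_add_eq_zero_left h)
    rw [Finset.prod_range_succ, Nat.cast_succ, ← add_assoc, Gamma_add_one _ h, ih]
    ring

theorem ne_neg_natCast_of_re_pos {x : ℂ} (hx : 0 < x.re) (m : ℕ) : x ≠ -m := by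
  rintro rfl
  simp at hx
  have : (0 : ℝ) ≤ m := Nat.cast_nonneg m
  linarith

theorem add_natCast_ne_neg_natCast {x : ℂ} (hx : ∀ m : ℕ, x ≠ -m) (k m : ℕ) : x + k ≠ -m := by
  intro h
  apply hx (m + k)
  push_cast
  linear_combination h

theorem Gamma_add_natCast_ne_zero {x : ℂ} (hx : ∀ m : ℕ, x ≠ -m) (k : ℕ) : Gamma (x + k) ≠ 0 :=
  Gamma_ne_zero (add_natCast_ne_neg_natCast hx k)

/-- The quotient `Γ(x+n)/Γ(y+n)` is asymptotic to `n^(x-y)`. -/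
theorem tendsto_Gamma_ratio (x y : ℂ) (hx : ∀ m : ℕ, x ≠ -m) (hy : ∀ m : ℕ, y ≠ -m) :
    Tendsto (fun n : ℕ => (n : ℂ) ^ (y - x) * (Gamma (x + n) / Gamma (y + n))) atTop (𝓝 1) := by
  have hX := GammaSeq_tendsto_Gamma x
  have hY := GammaSeq_tendsto_Gamma y
  have hgx : Gamma x ≠ 0 := Gamma_ne_zero hx
  have hgy : Gamma y ≠ 0 := Gamma_ne_zero hy
  have h1 : Tendsto (fun n : ℕ => (y + n) / (x + n)) atTop (𝓝 1) := by
    have hinv : Tendsto (fun n : ℕ => ((n : ℂ))⁻¹) atTop (𝓝 0) := tendsto_inv_atTop_nhds_zero_nat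
    have h2 : Tendsto (fun n : ℕ => (y * ((n : ℂ))⁻¹ + 1) / (x * ((n : ℂ))⁻¹ + 1)) atTop
        (𝓝 ((y * 0 + 1) / (x * 0 + 1))) :=
      ((hinv.const_mul y).add_const 1).div ((hinv.const_mul x).add_const 1) (by simp)
    simp only [mul_zero, zero_add, div_one] at h2
    refine h2.congr' ?_
    filter_upwards [eventually_ne_atTop 0] with n hn
    have hn' : (n : ℂ) ≠ 0 := Nat.cast_ne_zero.mpr hn
    have : x + n ≠ 0 := fun h => hx n (eq_neg_of_add_eq_zero_left h)
    have h3 : x * ((n : ℂ))⁻¹ + 1 ≠ 0 := by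
      intro h
      apply this
      field_simp at h
      simpa using h
    field_simp
  have h2 := ((hY.div_const (Gamma y)).mul ((hX.inv₀ hgx).mul_const (Gamma x))).mul h1
  rw [div_self hgy, inv_mul_cancel₀ hgx, one_mul, one_mul] at h2
  refine h2.congr' ?_
  filter_upwards [eventually_ne_atTop 0] with n hn
  have hn' : (n : ℂ) ≠ 0 := Nat.cast_ne_zero.mpr hn
  have hpx : ∏ j ∈ Finset.range n, (x + j) ≠ 0 := Finset.prod_ne_zero_iff.mpr
    fun j _ h => hx j (eq_neg_of_add_eq_zero_left h)
  have hpy : ∏ j ∈ Finset.range n, (y + j) ≠ 0 := Finset.prod_ne_zero_iff.mpr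
    fun j _ h => hy j (eq_neg_of_add_eq_zero_left h)
  have hx0 : x + n ≠ 0 := fun h => hx n (eq_neg_of_add_eq_zero_left h)
  have hy0 : y + n ≠ 0 := fun h => hy n (eq_neg_of_add_eq_zero_left h)
  have hfac : ((n.factorial : ℕ) : ℂ) ≠ 0 := Nat.cast_ne_zero.mpr n.factorial_ne_zero
  have hcx : (n : ℂ) ^ x ≠ 0 := by simp [cpow_eq_zero_iff, hn]
  rw [Gamma_add_natCast_eq_prod x hx, Gamma_add_natCast_eq_prod y hy, cpow_sub _ _ hn', GammaSeq,
    GammaSeq, Finset.prod_range_succ, Finset.prod_range_succ]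
  field_simp

theorem isBigO_Gamma_ratio (x y : ℂ) (hx : ∀ m : ℕ, x ≠ -m) (hy : ∀ m : ℕ, y ≠ -m) :
    (fun n : ℕ => Gamma (x + n) / Gamma (y + n)) =O[atTop] fun n : ℕ => (n : ℝ) ^ (x - y).re := by
  have h := (tendsto_Gamma_ratio x y hx hy).isBigO_one ℝ
  have h2 : (fun n : ℕ => (n : ℂ) ^ (x - y)) =O[atTop] fun n : ℕ => (n : ℝ) ^ (x - y).re := by
    refine IsBigO.of_bound 1 ?_
    filter_upwards [eventually_gt_atTop 0] with n hn
    rw [norm_natCast_cpow_of_pos hn, one_mul]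
    exact le_abs_self _
  refine (h2.mul h).congr' ?_ (by simp)
  filter_upwards [eventually_ne_atTop 0] with n hn
  have hn' : (n : ℂ) ≠ 0 := Nat.cast_ne_zero.mpr hn
  rw [← mul_assoc, ← cpow_add _ _ hn']
  simp

theorem exists_bound_of_isBigO_one {f : ℕ → ℂ} (h : f =O[atTop] fun _ : ℕ => (1 : ℝ)) :
    ∃ K : ℝ, ∀ n, ‖f n‖ ≤ K := by
  obtain ⟨K, hK⟩ := (isBigO_one_nat_atTop_iff).mp h
  exact ⟨K, hK⟩

theorem tsum_sub_succ {G : ℕ → ℂ} {l : ℂ} (hs : Summable fun k => G (k + 1) - G k)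
    (hG : Tendsto G atTop (𝓝 l)) : ∑' k, (G (k + 1) - G k) = l - G 0 := by
  have h1 := hs.hasSum.tendsto_sum_nat
  simp only [Finset.sum_range_sub] at h1
  exact tendsto_nhds_unique h1 (hG.sub_const _)

/-- The general term of Gauss's series `₂F₁(B, C; D; 1)`, normalised by Gamma factors. -/
def gaussTerm (B C D s : ℂ) : ℂ :=
  Gamma (B + s) * Gamma (C + s) / (Gamma (1 + s) * Gamma (D + s))

theorem isBigO_gaussTerm (B C D s : ℂ) (hB : ∀ m : ℕ, B + s ≠ -m) (hC : ∀ m : ℕ, C + s ≠ -m)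
    (h1 : ∀ m : ℕ, 1 + s ≠ -m) (hD : ∀ m : ℕ, D + s ≠ -m) :
    (fun n : ℕ => gaussTerm B C D (s + n)) =O[atTop]
      fun n : ℕ => (n : ℝ) ^ (B + C - D - 1).re := by
  refine ((isBigO_Gamma_ratio _ _ hB h1).mul (isBigO_Gamma_ratio _ _ hC hD)).congr' ?_ ?_
  · filter_upwards with n
    simp only [gaussTerm, add_assoc]
    rw [div_mul_div_comm]
  · filter_upwards [eventually_gt_atTop 0] with n hn
    rw [← Real.rpow_add (by exact_mod_cast hn)]
    congr 1
    simp
    ring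

theorem summable_gaussTerm (B C D s : ℂ) (hB : ∀ m : ℕ, B + s ≠ -m) (hC : ∀ m : ℕ, C + s ≠ -m)
    (h1 : ∀ m : ℕ, 1 + s ≠ -m) (hD : ∀ m : ℕ, D + s ≠ -m) (h : 0 < (D - B - C).re) :
    Summable fun n : ℕ => gaussTerm B C D (s + n) := by
  refine summable_of_isBigO_nat (Real.summable_nat_rpow.mpr ?_)
    (isBigO_gaussTerm B C D s hB hC h1 hD)
  simp at h ⊢
  linarith

theorem gaussTerm_add_one (B C D s : ℂ) (hB : B + s ≠ 0) (hC : C + s ≠ 0) (h1 : 1 + s ≠ 0)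
    (hD : D + s ≠ 0) : gaussTerm B C D (s + 1) =
      gaussTerm B C D s * ((B + s) * (C + s) / ((1 + s) * (D + s))) := by
  simp only [gaussTerm, ← add_assoc]
  rw [Gamma_add_one _ hB, Gamma_add_one _ hC, Gamma_add_one _ h1, Gamma_add_one _ hD]
  rw [div_mul_div_comm]
  congr 1 <;> ring

theorem gaussTerm_denom_add_one (B C D s : ℂ) (hD : D + s ≠ 0) :
    gaussTerm B C (D + 1) s = gaussTerm B C D s / (D + s) := by
  simp only [gaussTerm]
  rw [show D + 1 + s = D + s + 1 by ring, Gamma_add_one _ hD, div_div]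
  congr 1
  ring

theorem norm_Gamma_div_Gamma_le (D : ℂ) (hD : 0 < D.re) (n k : ℕ) :
    ‖Gamma (D + n) / Gamma (D + n + k)‖ ≤ ‖Gamma D / Gamma (D + k)‖ := by
  have h0 := ne_neg_natCast_of_re_pos hD
  have hn : ∀ m : ℕ, D + n ≠ -m := add_natCast_ne_neg_natCast h0 n
  rw [Gamma_add_natCast_eq_prod _ hn, Gamma_add_natCast_eq_prod D h0 k, div_mul_eq_div_div,
    div_mul_eq_div_div, div_self (Gamma_ne_zero hn), div_self (Gamma_ne_zero h0), norm_div, norm_div,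
    norm_prod, norm_prod]
  have hpos : ∀ j : ℕ, 0 < ‖D + j‖ := fun j => norm_pos_iff.mpr
    (fun h => h0 j (eq_neg_of_add_eq_zero_left h))
  refine div_le_div_of_nonneg_left (norm_nonneg _) (Finset.prod_pos fun j _ => hpos j) ?_
  refine Finset.prod_le_prod (fun j _ => norm_nonneg _) fun j _ => ?_
  rw [norm_def, norm_def]
  apply Real.sqrt_le_sqrt
  simp only [normSq_apply, add_re, add_im, natCast_re, natCast_im, add_zero]
  have : (0 : ℝ) ≤ n := Nat.cast_nonneg n
  have : (0 : ℝ) ≤ j := Nat.cast_nonneg j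
  nlinarith

theorem gauss_sum_contiguous (B C D : ℂ) (hB : 0 < B.re) (hC : 0 < C.re) (hD : 0 < D.re)
    (h : 0 < (D - B - C).re) :
    (D - B - C) * ∑' k : ℕ, gaussTerm B C D k =
      (D - B) * (D - C) * ∑' k : ℕ, gaussTerm B C (D + 1) k := by
  have hB0 := ne_neg_natCast_of_re_pos hB
  have hC0 := ne_neg_natCast_of_re_pos hC
  have hD0 := ne_neg_natCast_of_re_pos hD
  have h10 := ne_neg_natCast_of_re_pos (x := 1) (by simp)
  have hD1 := ne_neg_natCast_of_re_pos (x := D + 1) (by simp; linarith)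
  have hs1 : Summable fun k : ℕ => gaussTerm B C D k := by
    simpa using summable_gaussTerm B C D 0 (by simpa) (by simpa) (by simpa) (by simpa) h
  have hs2 : Summable fun k : ℕ => gaussTerm B C (D + 1) k := by
    simpa using summable_gaussTerm B C (D + 1) 0 (by simpa) (by simpa) (by simpa) (by simpa)
      (by simp at h ⊢; linarith)
  have hwz : ∀ k : ℕ, (D - B) * (D - C) * gaussTerm B C (D + 1) k -
      (D - B - C) * gaussTerm B C D k =
        ((k + 1 : ℕ) : ℂ) * gaussTerm B C D ((k + 1 : ℕ) : ℂ) - (k : ℂ) * gaussTerm B C D k := by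
    intro k
    have e1 : B + k ≠ 0 := fun h => hB0 k (eq_neg_of_add_eq_zero_left h)
    have e2 : C + k ≠ 0 := fun h => hC0 k (eq_neg_of_add_eq_zero_left h)
    have e3 : D + k ≠ 0 := fun h => hD0 k (eq_neg_of_add_eq_zero_left h)
    have e4 : (1 : ℂ) + k ≠ 0 := fun h => h10 k (eq_neg_of_add_eq_zero_left h)
    push_cast
    rw [gaussTerm_add_one _ _ _ _ e1 e2 e4 e3, gaussTerm_denom_add_one _ _ _ _ e3]
    field_simp
    ring
  have hG : Tendsto (fun k : ℕ => (k : ℂ) * gaussTerm B C D k) atTop (𝓝 0) := by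
    have hO := isBigO_gaussTerm B C D 0 (by simpa) (by simpa) (by simpa) (by simpa)
    have hk : (fun k : ℕ => (k : ℂ)) =O[atTop] fun k : ℕ => (k : ℝ) :=
      IsBigO.of_bound 1 (by simp)
    have hp : Tendsto (fun k : ℕ => (k : ℝ) * (k : ℝ) ^ (B + C - D - 1).re) atTop (𝓝 0) := by
      have := (tendsto_rpow_neg_atTop h).comp tendsto_natCast_atTop_atTop
      refine this.congr' ?_
      filter_upwards [eventually_gt_atTop 0] with k hk
      have hk' : (0 : ℝ) < k := by exact_mod_cast hk
      simp only [Function.comp]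
      nth_rewrite 2 [← Real.rpow_one (k : ℝ)]
      rw [← Real.rpow_add hk']
      congr 1
      simp
      ring
    simpa using (hk.mul hO).trans_tendsto hp
  have hsum := tsum_sub_succ (G := fun k : ℕ => (k : ℂ) * gaussTerm B C D k) (by
    refine ((hs2.mul_left ((D - B) * (D - C))).sub (hs1.mul_left (D - B - C))).congr ?_
    exact fun k => (hwz k)) hG
  have h2 := (hs2.mul_left ((D - B) * (D - C))).tsum_sub (hs1.mul_left (D - B - C))
  rw [tsum_mul_left, tsum_mul_left, tsum_congr hwz, hsum] at h2
  simp only [Nat.cast_zero, zero_mul, sub_zero] at h2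
  linear_combination h2

theorem tendsto_gauss_sum (B C D : ℂ) (hB : 0 < B.re) (hC : 0 < C.re) (hD : 0 < D.re)
    (h : 0 < (D - B - C).re) :
    Tendsto (fun n : ℕ => (∑' k : ℕ, gaussTerm B C (D + n) k) * Gamma (D + n)) atTop
      (𝓝 (Gamma B * Gamma C)) := by
  have hD0 := ne_neg_natCast_of_re_pos hD
  have hs1 : Summable fun k : ℕ => gaussTerm B C D k := by
    simpa using summable_gaussTerm B C D 0 (by simpa using ne_neg_natCast_of_re_pos hB)
      (by simpa using ne_neg_natCast_of_re_pos hC)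
      (by simpa using ne_neg_natCast_of_re_pos (x := 1) (by simp)) (by simpa) h
  have e : ∀ n k : ℕ, gaussTerm B C (D + n) k * Gamma (D + n) =
      (Gamma (B + k) * Gamma (C + k) / Gamma (1 + k)) * (Gamma (D + n) / Gamma (D + n + k)) := by
    intro n k
    rw [gaussTerm]
    ring
  have hlim : ∀ k : ℕ, Tendsto (fun n : ℕ => gaussTerm B C (D + n) k * Gamma (D + n)) atTop
      (𝓝 (if k = 0 then Gamma B * Gamma C else 0)) := by
    intro k
    split_ifs with hk
    · subst hk
      refine tendsto_const_nhds.congr fun n => ?_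
      rw [e]
      simp [div_self (Gamma_add_natCast_ne_zero hD0 n)]
    · have hO := isBigO_Gamma_ratio D (D + k) hD0 (add_natCast_ne_neg_natCast hD0 k)
      have h0 : Tendsto (fun n : ℕ => (n : ℝ) ^ (D - (D + k)).re) atTop (𝓝 0) := by
        have hk' : (0 : ℝ) < k := by exact_mod_cast Nat.pos_of_ne_zero hk
        refine ((tendsto_rpow_neg_atTop hk').comp tendsto_natCast_atTop_atTop).congr fun n => ?_
        simp
      have h1 := (hO.trans_tendsto h0).const_mul (Gamma (B + k) * Gamma (C + k) / Gamma (1 + k))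
      rw [mul_zero] at h1
      refine h1.congr fun n => ?_
      rw [e, add_right_comm]
  have hb := hs1.norm.mul_right ‖Gamma D‖
  have := tendsto_tsum_of_dominated_convergence hb hlim (.of_forall fun n k => by
    rw [e, norm_mul]
    refine (mul_le_mul_of_nonneg_left (norm_Gamma_div_Gamma_le D hD n k) (norm_nonneg _)).trans
      (le_of_eq ?_)
    rw [← norm_mul, ← norm_mul, gaussTerm]
    congr 1
    ring)
  rw [tsum_ite_eq] at this
  refine this.congr fun n => ?_
  rw [tsum_mul_right]

/-- **Gauss's summation theorem**. -/
theorem gauss_sum (B C D : ℂ) (hB : 0 < B.re) (hC : 0 < C.re) (hD : 0 < D.re)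
    (h : 0 < (D - B - C).re) :
    (∑' k : ℕ, gaussTerm B C D k) * (Gamma (D - B) * Gamma (D - C)) =
      Gamma B * Gamma C * Gamma (D - B - C) := by
  have hDB := ne_neg_natCast_of_re_pos (x := D - B) (by simp at h ⊢; linarith)
  have hDC := ne_neg_natCast_of_re_pos (x := D - C) (by simp at h ⊢; linarith)
  have hDBC := ne_neg_natCast_of_re_pos h
  have hD0 := ne_neg_natCast_of_re_pos hD
  have hconst : ∀ n : ℕ, (∑' k : ℕ, gaussTerm B C (D + n) k) *
      (Gamma (D - B + n) * Gamma (D - C + n)) / Gamma (D - B - C + n) =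
      (∑' k : ℕ, gaussTerm B C D k) * (Gamma (D - B) * Gamma (D - C)) / Gamma (D - B - C) := by
    intro n
    induction n with
    | zero => simp
    | succ n ih =>
      rw [← ih]
      have hn : (0 : ℝ) ≤ n := Nat.cast_nonneg n
      have h1 := gauss_sum_contiguous B C (D + n) hB hC (by simp; linarith)
        (by simp at h ⊢; linarith)
      have e1 : D - B + n ≠ 0 := fun h => hDB n (eq_neg_of_add_eq_zero_left h)
      have e2 : D - C + n ≠ 0 := fun h => hDC n (eq_neg_of_add_eq_zero_left h)
      have e3 : D - B - C + n ≠ 0 := fun h => hDBC n (eq_neg_of_add_eq_zero_left h)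
      have e4 := Gamma_add_natCast_ne_zero hDBC n
      push_cast
      simp only [← add_assoc]
      rw [Gamma_add_one _ e1, Gamma_add_one _ e2, Gamma_add_one _ e3, div_eq_div_iff
        (mul_ne_zero e3 e4) e4]
      linear_combination -Gamma (D - B + n) * Gamma (D - C + n) * Gamma (D - B - C + n) * h1
  have h1 := tendsto_gauss_sum B C D hB hC hD h
  have h2 := tendsto_Gamma_ratio (D - B) (D - B - C) hDB hDBC
  have h3 := tendsto_Gamma_ratio (D - C) D hDC hD0
  have h4 := (h1.mul h2).mul h3
  have h5 : (∑' k : ℕ, gaussTerm B C D k) * (Gamma (D - B) * Gamma (D - C)) / Gamma (D - B - C) =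
      Gamma B * Gamma C * 1 * 1 := by
    refine tendsto_nhds_unique (tendsto_const_nhds.congr' ?_) h4
    filter_upwards [eventually_ne_atTop 0] with n hn
    have hn' : (n : ℂ) ≠ 0 := Nat.cast_ne_zero.mpr hn
    rw [← hconst n]
    have e1 : (n : ℂ) ^ (D - B - C - (D - B)) * (n : ℂ) ^ (D - (D - C)) = 1 := by
      rw [← cpow_add _ _ hn']
      simp
    have e2 := Gamma_add_natCast_ne_zero hD0 n
    have e4 := Gamma_add_natCast_ne_zero hDBC n
    field_simp
    linear_combination
      (-(∑' k : ℕ, gaussTerm B C (D + n) k) * Gamma (D - B + n) * Gamma (D - C + n)) * e1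
  rw [div_eq_iff (Gamma_ne_zero hDBC)] at h5
  linear_combination h5

/-- The general term of a Saalschützian series `₃F₂(A, B, C; D, A + κ; 1)`. -/
def saalTerm (κ A B C D s : ℂ) : ℂ :=
  gaussTerm B C D s * (Gamma (A + s) / Gamma (A + κ + s))

theorem exists_bound_natCast_cpow_mul_Gamma_ratio (A κ : ℂ) (hA : 0 < A.re) (hκ : 0 ≤ κ.re) :
    ∃ K : ℝ, ∀ n : ℕ, ‖(n : ℂ) ^ κ * (Gamma (A + n) / Gamma (A + κ + n))‖ ≤ K := by
  refine exists_bound_of_isBigO_one ?_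
  have h := tendsto_Gamma_ratio A (A + κ) (ne_neg_natCast_of_re_pos hA)
    (ne_neg_natCast_of_re_pos (by simp; linarith))
  rw [add_sub_cancel_left] at h
  exact h.isBigO_one ℝ

theorem exists_bound_Gamma_ratio (A κ : ℂ) (hA : 0 < A.re) (hκ : 0 ≤ κ.re) :
    ∃ K : ℝ, ∀ n : ℕ, ‖Gamma (A + n) / Gamma (A + κ + n)‖ ≤ K := by
  refine exists_bound_of_isBigO_one ?_
  refine (isBigO_Gamma_ratio A (A + κ) (ne_neg_natCast_of_re_pos hA)
    (ne_neg_natCast_of_re_pos (by simp; linarith))).trans ?_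
  refine IsBigO.of_bound 1 ?_
  filter_upwards [eventually_ge_atTop 1] with n hn
  have hn' : (1 : ℝ) ≤ n := by exact_mod_cast hn
  rw [Real.norm_of_nonneg (by positivity), norm_one, one_mul]
  apply Real.rpow_le_one_of_one_le_of_nonpos hn'
  simpa using hκ

theorem natCast_cpow_norm_le {κ : ℂ} (hκ : 0 < κ.re) {m n : ℕ} (h : m ≤ n) :
    ‖(m : ℂ) ^ κ‖ ≤ ‖(n : ℂ) ^ κ‖ := by
  rcases Nat.eq_zero_or_pos m with rfl | hm
  · have : κ ≠ 0 := by
      rintro rfl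
      simp at hκ
    simp [zero_cpow this]
  · rw [norm_natCast_cpow_of_pos hm, norm_natCast_cpow_of_pos (hm.trans_le h)]
    exact Real.rpow_le_rpow (by positivity) (by exact_mod_cast h) hκ.le

/-- The parameters for which the ratio of Gamma values along `s + ℕ` behaves well. -/
structure SaalRegime (κ A B C D s : ℂ) : Prop where
  bal : κ + D = B + C + 1
  κ_pos : 0 < κ.re
  κ_lt : κ.re < 1
  A_pos : 0 < (A + s).re
  B_pos : 0 < (B + s).re
  C_pos : 0 < (C + s).re
  D_pos : 0 < (D + s).re
  one_pos : 0 < (1 + s).re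

theorem SaalRegime.summable_gaussTerm {κ A B C D s : ℂ} (h : SaalRegime κ A B C D s) :
    Summable fun k : ℕ => gaussTerm B C D (s + k) := by
  refine _root_.summable_gaussTerm B C D s (ne_neg_natCast_of_re_pos h.B_pos)
    (ne_neg_natCast_of_re_pos h.C_pos) (ne_neg_natCast_of_re_pos h.one_pos)
    (ne_neg_natCast_of_re_pos h.D_pos) ?_
  have : D - B - C = 1 - κ := by linear_combination h.bal
  rw [this]
  have := h.κ_lt
  simpa

theorem SaalRegime.summable_saalTerm {κ A B C D s : ℂ} (h : SaalRegime κ A B C D s) :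
    Summable fun k : ℕ => saalTerm κ A B C D (s + k) := by
  obtain ⟨K, hK⟩ := exists_bound_Gamma_ratio (A + s) κ h.A_pos h.κ_pos.le
  refine Summable.of_norm_bounded (h.summable_gaussTerm.norm.mul_right K) fun k => ?_
  rw [saalTerm, norm_mul]
  refine mul_le_mul_of_nonneg_left ?_ (norm_nonneg _)
  rw [show A + κ + (s + k) = A + s + κ + k by ring, ← add_assoc A]
  exact hK k

theorem SaalRegime.add_natCast {κ A B C D s : ℂ} (h : SaalRegime κ A B C D s) (n : ℕ) :
    SaalRegime κ (A + n) B C D s := by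
  refine { h with A_pos := ?_ }
  have h1 := h.A_pos
  have hn : (0 : ℝ) ≤ n := Nat.cast_nonneg n
  simp at h1 ⊢
  linarith

theorem SaalRegime.tendsto_boundary {κ A B C D s : ℂ} (h : SaalRegime κ A B C D s) :
    Tendsto (fun k : ℕ => (s + k) * (s + k + D - 1) * saalTerm κ A B C D (s + k)) atTop (𝓝 1) := by
  have h1 := tendsto_Gamma_ratio (B + s) (1 + s) (ne_neg_natCast_of_re_pos h.B_pos)
    (ne_neg_natCast_of_re_pos h.one_pos)
  have h2 := tendsto_Gamma_ratio (C + s) (D + s) (ne_neg_natCast_of_re_pos h.C_pos)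
    (ne_neg_natCast_of_re_pos h.D_pos)
  have h3 := tendsto_Gamma_ratio (A + s) (A + κ + s) (ne_neg_natCast_of_re_pos h.A_pos)
    (ne_neg_natCast_of_re_pos (by
      have := h.A_pos
      have := h.κ_pos
      simp at *
      linarith))
  have h4 : ∀ x : ℂ, Tendsto (fun k : ℕ => x * ((k : ℂ))⁻¹ + 1) atTop (𝓝 1) := fun x => by
    simpa using ((tendsto_inv_atTop_nhds_zero_nat (𝕜 := ℂ)).const_mul x).add_const 1
  have h5 := (((h1.mul h2).mul h3).mul (h4 s)).mul (h4 (s + D - 1))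
  simp only [mul_one] at h5
  refine h5.congr' ?_
  filter_upwards [eventually_ne_atTop 0] with k hk
  have hk' : (k : ℂ) ≠ 0 := Nat.cast_ne_zero.mpr hk
  have e : (k : ℂ) ^ (1 + s - (B + s)) * (k : ℂ) ^ (D + s - (C + s)) *
      (k : ℂ) ^ (A + κ + s - (A + s)) = (k : ℂ) ^ 2 := by
    rw [← cpow_add _ _ hk', ← cpow_add _ _ hk', ← cpow_ofNat]
    congr 1
    linear_combination h.bal
  simp only [saalTerm, gaussTerm, ← add_assoc]
  field_simp
  linear_combination (Gamma (B + s + k) * Gamma (C + s + k) * Gamma (A + s + k) * (s + k) *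
    (s + D - 1 + k) / (Gamma (1 + s + k) * Gamma (D + s + k) * Gamma (A + κ + s + k))) * e

theorem saalTerm_add_one (κ A B C D s : ℂ) (hA : A + s ≠ 0) (hB : B + s ≠ 0) (hC : C + s ≠ 0)
    (h1 : 1 + s ≠ 0) (hD : D + s ≠ 0) (hE : A + κ + s ≠ 0) : saalTerm κ A B C D (s + 1) =
      saalTerm κ A B C D s *
        ((A + s) * (B + s) * (C + s) / ((1 + s) * (D + s) * (A + κ + s))) := by
  simp only [saalTerm]
  rw [gaussTerm_add_one _ _ _ _ hB hC h1 hD, ← add_assoc, ← add_assoc, Gamma_add_one _ hA,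
    Gamma_add_one _ hE, mul_div_mul_comm (A + s) (Gamma (A + s))]
  field_simp

theorem saalTerm_param_add_one (κ A B C D s : ℂ) (hA : A + s ≠ 0) (hE : A + κ + s ≠ 0) :
    saalTerm κ (A + 1) B C D s = saalTerm κ A B C D s * ((A + s) / (A + κ + s)) := by
  simp only [saalTerm]
  rw [show A + 1 + s = A + s + 1 by ring, show A + 1 + κ + s = A + κ + s + 1 by ring,
    Gamma_add_one _ hA, Gamma_add_one _ hE, mul_div_mul_comm]
  ring

theorem SaalRegime.contiguous {κ A B C D s : ℂ} (h : SaalRegime κ A B C D s) :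
    (A + κ - B) * (A + κ - C) * ∑' k : ℕ, saalTerm κ (A + 1) B C D (s + k) -
      A * (1 + A - D) * ∑' k : ℕ, saalTerm κ A B C D (s + k) =
        1 - s * (s + D - 1) * saalTerm κ A B C D s := by
  have hA := ne_neg_natCast_of_re_pos h.A_pos
  have hB := ne_neg_natCast_of_re_pos h.B_pos
  have hC := ne_neg_natCast_of_re_pos h.C_pos
  have hD := ne_neg_natCast_of_re_pos h.D_pos
  have h1 := ne_neg_natCast_of_re_pos h.one_pos
  have hE := ne_neg_natCast_of_re_pos (x := A + κ + s) (by
      have := h.A_pos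
      have := h.κ_pos
      simp at *
      linarith)
  have hs1 := h.summable_saalTerm
  have hs2 : Summable fun k : ℕ => saalTerm κ (A + 1) B C D (s + k) := by
    simpa using (h.add_natCast 1).summable_saalTerm
  have hwz : ∀ k : ℕ, (A + κ - B) * (A + κ - C) * saalTerm κ (A + 1) B C D (s + k) -
      A * (1 + A - D) * saalTerm κ A B C D (s + k) =
      (s + (k + 1 : ℕ)) * (s + (k + 1 : ℕ) + D - 1) * saalTerm κ A B C D (s + (k + 1 : ℕ)) -
        (s + k) * (s + k + D - 1) * saalTerm κ A B C D (s + k) := by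
    intro k
    have key : ∀ x : ℂ, (∀ m : ℕ, x + s ≠ -m) → x + (s + k) ≠ 0 := fun x hx h =>
      hx k (by linear_combination h)
    have e1 := key _ hA
    have e2 := key _ hB
    have e3 := key _ hC
    have e4 := key _ hD
    have e5 := key _ h1
    have e6 := key _ hE
    push_cast
    rw [← add_assoc s (k : ℂ) 1, saalTerm_add_one _ _ _ _ _ _ e1 e2 e3 e5 e4 e6,
      saalTerm_param_add_one _ _ _ _ _ _ e1 e6]
    have hκ : κ = B + C + 1 - D := by linear_combination h.bal
    generalize saalTerm κ A B C D (s + k) = τ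
    subst hκ
    field_simp
    ring
  have hsum := tsum_sub_succ
    (G := fun k : ℕ => (s + k) * (s + k + D - 1) * saalTerm κ A B C D (s + k))
    (((hs2.mul_left _).sub (hs1.mul_left _)).congr fun k => (hwz k)) h.tendsto_boundary
  have h2 := (hs2.mul_left ((A + κ - B) * (A + κ - C))).tsum_sub (hs1.mul_left (A * (1 + A - D)))
  rw [tsum_mul_left, tsum_mul_left, tsum_congr hwz, hsum] at h2
  simp only [Nat.cast_zero, add_zero] at h2
  linear_combination -h2

theorem SaalRegime.tendsto_param {κ A B C D s : ℂ} (h : SaalRegime κ A B C D s) :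
    Tendsto (fun n : ℕ => (n : ℂ) ^ κ * ∑' k : ℕ, saalTerm κ (A + n) B C D (s + k)) atTop
      (𝓝 (∑' k : ℕ, gaussTerm B C D (s + k))) := by
  obtain ⟨K, hK⟩ := exists_bound_natCast_cpow_mul_Gamma_ratio (A + s) κ h.A_pos h.κ_pos.le
  have hA := ne_neg_natCast_of_re_pos h.A_pos
  have hE := ne_neg_natCast_of_re_pos (x := A + κ + s) (by
      have := h.A_pos
      have := h.κ_pos
      simp at *
      linarith)
  have := tendsto_tsum_of_dominated_convergence (𝓕 := atTop)
    (f := fun n k : ℕ => (n : ℂ) ^ κ * saalTerm κ (A + n) B C D (s + k))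
    (g := fun k : ℕ => gaussTerm B C D (s + k))
    (h.summable_gaussTerm.norm.mul_right K) (fun k => ?_) (.of_forall fun n k => ?_)
  · refine this.congr fun n => ?_
    rw [tsum_mul_left]
  · have h1 := (tendsto_Gamma_ratio (A + s + k) (A + κ + s + k)
      (add_natCast_ne_neg_natCast hA k) (add_natCast_ne_neg_natCast hE k)).const_mul
        (gaussTerm B C D (s + k))
    rw [mul_one] at h1
    refine h1.congr fun n => ?_
    rw [saalTerm, show A + κ + s + k - (A + s + k) = κ by ring,
      show A + n + (s + k) = A + s + k + n by ring,
      show A + n + κ + (s + k) = A + κ + s + k + n by ring]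
    ring
  · rw [saalTerm, mul_left_comm, norm_mul]
    refine mul_le_mul_of_nonneg_left ?_ (norm_nonneg _)
    refine le_trans ?_ (hK (n + k))
    rw [norm_mul, norm_mul, show A + n + (s + k) = A + s + (n + k : ℕ) by push_cast; ring,
      show A + n + κ + (s + k) = A + s + κ + (n + k : ℕ) by push_cast; ring]
    exact mul_le_mul_of_nonneg_right (natCast_cpow_norm_le h.κ_pos (Nat.le_add_right n k))
      (norm_nonneg _)

theorem inv_Gamma_mul_inv_Gamma_one_sub (x : ℂ) :
    (Gamma x)⁻¹ * (Gamma (1 - x))⁻¹ = Sn x / Real.pi := by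
  rw [← mul_inv, Gamma_mul_Gamma_one_sub, inv_div, Sn]

theorem inv_Gamma_eq (x : ℂ) (hx : Gamma (1 - x) ≠ 0) :
    (Gamma x)⁻¹ = Gamma (1 - x) * Sn x / Real.pi := by
  rw [mul_div_assoc, ← inv_Gamma_mul_inv_Gamma_one_sub]
  field_simp

theorem Sn_sub (x y : ℂ) : Sn (x - y) = Sn x * cos (Real.pi * y) - cos (Real.pi * x) * Sn y := by
  rw [Sn, mul_sub, sin_sub]
  rfl

theorem Sn_neg (x : ℂ) : Sn (-x) = -Sn x := by
  rw [Sn, mul_neg, sin_neg]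
  rfl

theorem Sn_one_sub (x : ℂ) : Sn (1 - x) = Sn x := by
  simp only [Sn_sub]
  simp [Sn]

theorem Sn_sub_mul_Sn_sub_sub (B C D : ℂ) :
    Sn (D - B) * Sn (D - C) - Sn B * Sn C = Sn D * Sn (D - B - C) := by
  simp only [Sn, mul_sub, sin_sub, cos_sub]
  linear_combination (sin (Real.pi * B) * sin (Real.pi * C)) * sin_sq_add_cos_sq (Real.pi * D)

theorem gauss_sum_sub (κ B C D : ℂ) (hbal : κ + D = B + C + 1) (hκ : κ.re < 1)
    (hB : 0 < B.re) (hC : 0 < C.re) (hD : 0 < D.re) (hB' : 0 < (B + 1 - D).re)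
    (hC' : 0 < (C + 1 - D).re) (hD' : 0 < (2 - D).re) :
    ∑' k : ℕ, gaussTerm B C D k - ∑' k : ℕ, gaussTerm B C D (1 - D + k) =
      Sn D / Real.pi * (Gamma κ)⁻¹ * Gamma B * Gamma C * Gamma (1 + B - D) * Gamma (1 + C - D) := by
  have e1 : D - B - C = 1 - κ := by linear_combination hbal
  have hk : 0 < (1 - κ).re := by simpa
  have h1 := gauss_sum B C D hB hC hD (by rwa [e1])
  have h2 := gauss_sum (B + 1 - D) (C + 1 - D) (2 - D) hB' hC' hD'
    (by rwa [show 2 - D - (B + 1 - D) - (C + 1 - D) = 1 - κ by linear_combination hbal])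
  rw [show 2 - D - (B + 1 - D) - (C + 1 - D) = 1 - κ by linear_combination hbal,
    show 2 - D - (B + 1 - D) = 1 - B by ring, show 2 - D - (C + 1 - D) = 1 - C by ring] at h2
  rw [e1] at h1
  have e2 : ∀ k : ℕ, gaussTerm B C D (1 - D + k) =
      gaussTerm (B + 1 - D) (C + 1 - D) (2 - D) k := fun k => by
    simp only [gaussTerm]
    rw [show B + (1 - D + k) = B + 1 - D + k by ring, show C + (1 - D + k) = C + 1 - D + k by ring,
      show 1 + (1 - D + k) = 2 - D + k by ring, show D + (1 - D + k) = 1 + k by ring,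
      mul_comm (Gamma (1 + k : ℂ))]
  rw [tsum_congr e2]
  have g : ∀ {x : ℂ}, 0 < x.re → Gamma x ≠ 0 := fun h => Gamma_ne_zero_of_re_pos h
  have p1 : Gamma (D - B) ≠ 0 := g (by
    rw [show D - B = (1 - κ) + C by linear_combination e1]
    rw [add_re]; positivity)
  have p2 : Gamma (D - C) ≠ 0 := g (by
    rw [show D - C = (1 - κ) + B by linear_combination e1]
    rw [add_re]; positivity)
  have p3 : Gamma (1 - B) ≠ 0 := g (by
    rw [show 1 - B = (1 - κ) + (C + 1 - D) by linear_combination e1]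
    rw [add_re]; positivity)
  have p4 : Gamma (1 - C) ≠ 0 := g (by
    rw [show 1 - C = (1 - κ) + (B + 1 - D) by linear_combination e1]
    rw [add_re]; positivity)
  have r1 := inv_Gamma_eq (D - B) (by
    rw [show 1 - (D - B) = B + 1 - D by ring]; exact g hB')
  have r2 := inv_Gamma_eq (D - C) (by
    rw [show 1 - (D - C) = C + 1 - D by ring]; exact g hC')
  have r3 := inv_Gamma_eq (1 - B) (by
    rw [show 1 - (1 - B) = B by ring]; exact g hB)
  have r4 := inv_Gamma_eq (1 - C) (by
    rw [show 1 - (1 - C) = C by ring]; exact g hC)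
  have r5 := inv_Gamma_eq κ (g hk)
  have h1' : ∑' k : ℕ, gaussTerm B C D k =
      Gamma B * Gamma C * Gamma (1 - κ) * (Gamma (D - B))⁻¹ * (Gamma (D - C))⁻¹ := by
    rw [← h1]; field_simp
  have h2' : ∑' k : ℕ, gaussTerm (B + 1 - D) (C + 1 - D) (2 - D) k =
      Gamma (B + 1 - D) * Gamma (C + 1 - D) * Gamma (1 - κ) * (Gamma (1 - B))⁻¹ *
        (Gamma (1 - C))⁻¹ := by
    rw [← h2]; field_simp
  rw [h1', h2', r1, r2, r3, r4, r5, show 1 - (1 - B) = B by ring, show 1 - (1 - C) = C by ring,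
    show 1 - (D - B) = B + 1 - D by ring, show 1 - (D - C) = C + 1 - D by ring, Sn_one_sub,
    Sn_one_sub, show 1 + B - D = B + 1 - D by ring, show 1 + C - D = C + 1 - D by ring]
  have s := Sn_sub_mul_Sn_sub_sub B C D
  rw [e1, Sn_one_sub] at s
  linear_combination (Gamma B * Gamma C * Gamma (1 - κ) * Gamma (B + 1 - D) * Gamma (C + 1 - D) /
    (Real.pi : ℂ) ^ 2) * s

/-- The nonterminating form of the Saalschütz summation theorem. -/
theorem saalschutz_sum_sub {κ A B C D : ℂ} (h0 : SaalRegime κ A B C D 0)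
    (h1 : SaalRegime κ A B C D (1 - D)) :
    (∑' k : ℕ, saalTerm κ A B C D k - ∑' k : ℕ, saalTerm κ A B C D (1 - D + k)) *
        (Gamma (A + κ - B) * Gamma (A + κ - C)) =
      (Sn D / Real.pi * (Gamma κ)⁻¹ * Gamma B * Gamma C * Gamma (1 + B - D) * Gamma (1 + C - D)) *
        (Gamma A * Gamma (1 + A - D)) := by
  have hbal := h0.bal
  have hA0 : 0 < A.re := by simpa using h0.A_pos
  have hB0 : 0 < B.re := by simpa using h0.B_pos
  have hC0 : 0 < C.re := by simpa using h0.C_pos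
  have hD0 : 0 < D.re := by simpa using h0.D_pos
  have hA1 : 0 < (1 + A - D).re := by
    have := h1.A_pos
    rwa [show A + (1 - D) = 1 + A - D by ring] at this
  have hB1 : 0 < (B + 1 - D).re := by
    have := h1.B_pos
    rwa [show B + (1 - D) = B + 1 - D by ring] at this
  have hC1 : 0 < (C + 1 - D).re := by
    have := h1.C_pos
    rwa [show C + (1 - D) = C + 1 - D by ring] at this
  have hD1 : 0 < (2 - D).re := by
    have := h1.one_pos
    rwa [show 1 + (1 - D) = 2 - D by ring] at this
  have hA := ne_neg_natCast_of_re_pos hA0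
  have hA' := ne_neg_natCast_of_re_pos hA1
  have hEB := ne_neg_natCast_of_re_pos (x := A + κ - B) (by
    rw [show A + κ - B = A + (C + 1 - D) by linear_combination hbal, add_re]; positivity)
  have hEC := ne_neg_natCast_of_re_pos (x := A + κ - C) (by
    rw [show A + κ - C = A + (B + 1 - D) by linear_combination hbal, add_re]; positivity)
  set N : ℕ → ℂ := fun n => ∑' k : ℕ, saalTerm κ (A + n) B C D k -
    ∑' k : ℕ, saalTerm κ (A + n) B C D (1 - D + k) with hN
  have hrec : ∀ n, (A + κ - B + n) * (A + κ - C + n) * N (n + 1) =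
      (A + n) * (1 + A - D + n) * N n := by
    intro n
    have c0 := (h0.add_natCast n).contiguous
    have c1 := (h1.add_natCast n).contiguous
    simp only [zero_add] at c0
    simp only [hN, Nat.cast_add, Nat.cast_one, ← add_assoc]
    linear_combination c0 - c1
  have hconst : ∀ n : ℕ, N n * (Gamma (A + κ - B + n) * Gamma (A + κ - C + n)) /
      (Gamma (A + n) * Gamma (1 + A - D + n)) =
        N 0 * (Gamma (A + κ - B) * Gamma (A + κ - C)) / (Gamma A * Gamma (1 + A - D)) := by
    intro n
    induction n with
    | zero => simp
    | succ n ih =>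
      rw [← ih]
      have e1 : A + κ - B + n ≠ 0 := fun h => hEB n (eq_neg_of_add_eq_zero_left h)
      have e2 : A + κ - C + n ≠ 0 := fun h => hEC n (eq_neg_of_add_eq_zero_left h)
      have e3 : A + n ≠ 0 := fun h => hA n (eq_neg_of_add_eq_zero_left h)
      have e4 : 1 + A - D + n ≠ 0 := fun h => hA' n (eq_neg_of_add_eq_zero_left h)
      have e5 := Gamma_add_natCast_ne_zero hA n
      have e6 := Gamma_add_natCast_ne_zero hA' n
      push_cast
      simp only [← add_assoc]
      rw [Gamma_add_one _ e1, Gamma_add_one _ e2, Gamma_add_one _ e3, Gamma_add_one _ e4,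
        div_eq_div_iff (mul_ne_zero (mul_ne_zero e3 e5) (mul_ne_zero e4 e6)) (mul_ne_zero e5 e6)]
      linear_combination (Gamma (A + κ - B + n) * Gamma (A + κ - C + n) *
        (Gamma (A + n) * Gamma (1 + A - D + n))) * hrec n
  have t0 := h0.tendsto_param
  have t1 := h1.tendsto_param
  simp only [zero_add] at t0
  have t2 := t0.sub t1
  rw [gauss_sum_sub κ B C D hbal h0.κ_lt hB0 hC0 hD0 hB1 hC1 hD1] at t2
  have t3 := tendsto_Gamma_ratio (A + κ - B) A hEB hA
  have t4 := tendsto_Gamma_ratio (A + κ - C) (1 + A - D) hEC hA'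
  have t5 := (t2.mul t3).mul t4
  simp only [mul_one] at t5
  have hfin : N 0 * (Gamma (A + κ - B) * Gamma (A + κ - C)) / (Gamma A * Gamma (1 + A - D)) =
      Sn D / Real.pi * (Gamma κ)⁻¹ * Gamma B * Gamma C * Gamma (1 + B - D) * Gamma (1 + C - D) := by
    refine tendsto_nhds_unique (tendsto_const_nhds.congr' ?_) t5
    filter_upwards [eventually_ne_atTop 0] with n hn
    have hn' : (n : ℂ) ≠ 0 := Nat.cast_ne_zero.mpr hn
    have e : (n : ℂ) ^ κ * (n : ℂ) ^ (A - (A + κ - B)) *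
        (n : ℂ) ^ (1 + A - D - (A + κ - C)) = 1 := by
      rw [← cpow_add _ _ hn', ← cpow_add _ _ hn', show κ + (A - (A + κ - B)) +
        (1 + A - D - (A + κ - C)) = 0 by linear_combination -hbal, cpow_zero]
    rw [← mul_sub, ← hconst n, mul_div_assoc, mul_div_mul_comm]
    linear_combination (-N n * (Gamma (A + κ - B + n) / Gamma (A + n) *
      (Gamma (A + κ - C + n) / Gamma (1 + A - D + n)))) * e
  rw [div_eq_iff (mul_ne_zero (Gamma_ne_zero hA) (Gamma_ne_zero hA'))] at hfin
  simpa [hN] using hfin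

theorem Fstar_eq_tsum (a b c d e f g : ℂ) : Fstar a b c d e f g =
    ∑' k : ℕ, Gamma (a + k) * Gamma (b + k) * Gamma (c + k) * Gamma (d + k) /
      (Gamma (1 + k) * Gamma (e + k) * Gamma (f + k) * Gamma (g + k)) := by
  refine tsum_congr fun k => ?_
  simp only [add_comm (k : ℂ)]
  rw [add_comm 1 (k : ℂ), Gamma_nat_eq_factorial]

theorem Fstar_eq_tsum' (a b c d e f g : ℂ) : Fstar a b c d e f g =
    ∑' k : ℕ, Gamma (a + k) * Gamma (b + k) * Gamma (c + k) * Gamma (d + k) /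
      (Gamma (e + k) * Gamma (1 + k) * Gamma (f + k) * Gamma (g + k)) := by
  rw [Fstar_eq_tsum]
  refine tsum_congr fun k => ?_
  rw [mul_comm (Gamma (1 + k : ℂ))]

theorem summable_prod_mul_bounded {X Y Q : ℕ → ℂ} (hX : Summable X) (hY : Summable Y)
    (hQ : ∃ K : ℝ, ∀ n, ‖Q n‖ ≤ K) :
    Summable (Function.uncurry fun j k : ℕ => X j * Y k * Q (j + k)) := by
  obtain ⟨K, hK⟩ := hQ
  refine Summable.of_norm_bounded
    ((summable_mul_of_summable_norm hX.norm hY.norm).norm.mul_right K) fun p => ?_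
  rw [Function.uncurry, norm_mul]
  refine mul_le_mul_of_nonneg_left (hK _) (norm_nonneg _)

theorem Gamma_ratio_bounded (A κ r s : ℂ) (hA : 0 < (A + (r + s)).re) (hκ : 0 < κ.re) :
    ∃ K : ℝ, ∀ n : ℕ, ‖Gamma (A + (r + s + n)) / Gamma (A + κ + (r + s + n))‖ ≤ K := by
  obtain ⟨K, hK⟩ := exists_bound_Gamma_ratio (A + (r + s)) κ hA hκ.le
  refine ⟨K, fun n => ?_⟩
  rw [show A + κ + (r + s + n) = A + (r + s) + κ + n by ring,
    show A + (r + s + n) = A + (r + s) + n by ring]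
  exact hK n

theorem saalschutz_sum_sub' {κ A B C D E₁ E₂ A' : ℂ} (h0 : SaalRegime κ A B C D 0)
    (h1 : SaalRegime κ A B C D (1 - D)) (e₁ : A + κ - B = E₁) (e₂ : A + κ - C = E₂)
    (eA : 1 + A - D = A') (hE₁ : 0 < E₁.re) (hE₂ : 0 < E₂.re) :
    ∑' k : ℕ, saalTerm κ A B C D (0 + k) - ∑' k : ℕ, saalTerm κ A B C D (1 - D + k) =
      (Sn D / Real.pi * (Gamma κ)⁻¹ * Gamma B * Gamma C * Gamma (1 + B - D) * Gamma (1 + C - D)) *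
        (Gamma A * Gamma A' / (Gamma E₁ * Gamma E₂)) := by
  have := saalschutz_sum_sub h0 h1
  rw [e₁, e₂, eA] at this
  simp only [zero_add]
  rw [← mul_div_assoc, eq_div_iff (mul_ne_zero (Gamma_ne_zero_of_re_pos hE₁)
    (Gamma_ne_zero_of_re_pos hE₂)), this]

/-- Parameters for which the double series behind the two-term transformation converges. -/
structure TransformRegime (a b c d e f g : ℂ) : Prop where
  bal : e + f + g = a + b + c + d + 1
  κ_pos : 0 < (f + g - a - b).re
  κ_lt : (f + g - a - b).re < 1
  a_pos : 0 < a.re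
  b_pos : 0 < b.re
  c_pos : 0 < c.re
  d_pos : 0 < d.re
  ae_pos : 0 < (1 + a - e).re
  be_pos : 0 < (1 + b - e).re
  ce_pos : 0 < (1 + c - e).re
  de_pos : 0 < (1 + d - e).re
  fa_pos : 0 < (f - a).re
  fb_pos : 0 < (f - b).re
  ga_pos : 0 < (g - a).re
  gb_pos : 0 < (g - b).re
  e_pos : 0 < e.re
  e_lt : 0 < (2 - e).re
  ab_pos : 0 < (1 + a - b).re
  ba_pos : 0 < (1 + b - a).re

theorem TransformRegime.Fstar_sub {a b c d e f g : ℂ} (h : TransformRegime a b c d e f g) :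
    (Sn (1 + a - b) / Real.pi * (Gamma (f + g - a - b))⁻¹ * Gamma (f - b) * Gamma (g - b) *
        Gamma (f - a) * Gamma (g - a)) *
      (Fstar a b c d e f g -
        Fstar (1 + a - e) (1 + b - e) (1 + c - e) (1 + d - e) (2 - e) (1 + f - e) (1 + g - e)) =
    (Sn e / Real.pi * (Gamma (f + g - a - b))⁻¹ * Gamma c * Gamma d * Gamma (1 + c - e) *
        Gamma (1 + d - e)) *
      (Fstar (f - b) (g - b) a (1 + a - e) (1 + a - b) (1 + a + c - e) (1 + a + d - e) -
        Fstar (f - a) (g - a) b (1 + b - e) (1 + b - a) (1 + b + c - e) (1 + b + d - e)) := by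
  set κ := f + g - a - b with hκ
  have hbal := h.bal
  set X : ℂ → ℂ := gaussTerm (f - b) (g - b) (1 + a - b) with hX
  set Y : ℂ → ℂ := gaussTerm c d e with hY
  set Q : ℂ → ℂ := fun t => Gamma (a + t) / Gamma (a + κ + t) with hQ
  have nn : ∀ k : ℕ, (0 : ℝ) ≤ k := fun k => Nat.cast_nonneg k
  have hx0 : ∀ r : ℂ, 0 < (a + r).re → SaalRegime κ (a + r) (f - b) (g - b) (1 + a - b) 0 :=
    fun r hr => ⟨by rw [hκ]; ring, h.κ_pos, h.κ_lt, by simpa using hr, by simpa using h.fb_pos,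
      by simpa using h.gb_pos, by simpa using h.ab_pos, by simp⟩
  have hx1 : ∀ r : ℂ, 0 < (b + r).re →
      SaalRegime κ (a + r) (f - b) (g - b) (1 + a - b) (1 - (1 + a - b)) :=
    fun r hr => ⟨by rw [hκ]; ring, h.κ_pos, h.κ_lt, by convert hr using 2; ring,
      by convert h.fa_pos using 2; ring, by convert h.ga_pos using 2; ring, by simp,
      by convert h.ba_pos using 2; ring⟩
  have hy0 : ∀ s : ℂ, 0 < (a + s).re → SaalRegime κ (a + s) c d e 0 :=
    fun s hs => ⟨by rw [hκ]; linear_combination hbal, h.κ_pos, h.κ_lt, by simpa using hs,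
      by simpa using h.c_pos, by simpa using h.d_pos, by simpa using h.e_pos, by simp⟩
  have hy1 : ∀ s : ℂ, 0 < (1 + a - e + s).re → SaalRegime κ (a + s) c d e (1 - e) :=
    fun s hs => ⟨by rw [hκ]; linear_combination hbal, h.κ_pos, h.κ_lt,
      by convert hs using 2; ring, by convert h.ce_pos using 2; ring,
      by convert h.de_pos using 2; ring, by simp, by convert h.e_lt using 2; ring⟩
  have sX0 : Summable fun j : ℕ => X (0 + j) := (hx0 0 (by simpa using h.a_pos)).summable_gaussTerm
  have sX1 : Summable fun j : ℕ => X (1 - (1 + a - b) + j) :=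
    (hx1 0 (by simpa using h.b_pos)).summable_gaussTerm
  have sY0 : Summable fun j : ℕ => Y (0 + j) := (hy0 0 (by simpa using h.a_pos)).summable_gaussTerm
  have sY1 : Summable fun j : ℕ => Y (1 - e + j) :=
    (hy1 0 (by simpa using h.ae_pos)).summable_gaussTerm
  have hs : ∀ σ ρ : ℂ, Summable (fun j : ℕ => X (σ + j)) → Summable (fun k : ℕ => Y (ρ + k)) →
      0 < (a + (σ + ρ)).re → Summable (Function.uncurry fun j k : ℕ =>
        X (σ + j) * Y (ρ + k) * Q (σ + ρ + (j + k : ℕ))) := fun σ ρ h1 h2 h3 =>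
    summable_prod_mul_bounded (Q := fun n : ℕ => Q (σ + ρ + n)) h1 h2
      (Gamma_ratio_bounded a κ σ ρ h3 h.κ_pos)
  have s00 := hs 0 0 sX0 sY0 (by simpa using h.a_pos)
  have s10 := hs _ 0 sX1 sY0 (by convert h.b_pos using 2; ring)
  have s01 := hs 0 _ sX0 sY1 (by convert h.ae_pos using 2; ring)
  have s11 := hs _ _ sX1 sY1 (by convert h.be_pos using 2; ring)
  -- summation over the first index
  have inner1 : ∀ ρ : ℂ, 0 < (a + ρ).re → 0 < (b + ρ).re → ∀ k : ℕ,
      ∑' j : ℕ, X (0 + j) * Y (ρ + k) * Q (0 + ρ + (j + k : ℕ)) -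
        ∑' j : ℕ, X (1 - (1 + a - b) + j) * Y (ρ + k) * Q (1 - (1 + a - b) + ρ + (j + k : ℕ)) =
      (Sn (1 + a - b) / Real.pi * (Gamma κ)⁻¹ * Gamma (f - b) * Gamma (g - b) *
        Gamma (f - a) * Gamma (g - a)) * (Gamma (a + ρ + k) * Gamma (b + ρ + k) *
          Gamma (c + ρ + k) * Gamma (d + ρ + k) / (Gamma (1 + ρ + k) * Gamma (e + ρ + k) *
            Gamma (f + ρ + k) * Gamma (g + ρ + k))) := by
    intro ρ ha hb k
    have hfa := h.fa_pos
    have hga := h.ga_pos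
    have hk := nn k
    have key := saalschutz_sum_sub' (hx0 (ρ + k) (by simp at ha ⊢; linarith))
      (hx1 (ρ + k) (by simp at hb ⊢; linarith))
      (show a + (ρ + k) + κ - (f - b) = g + ρ + k by rw [hκ]; ring)
      (show a + (ρ + k) + κ - (g - b) = f + ρ + k by rw [hκ]; ring)
      (show 1 + (a + (ρ + k)) - (1 + a - b) = b + ρ + k by ring)
      (by simp at ha hga ⊢; linarith) (by simp at ha hfa ⊢; linarith)
    rw [show 1 + (f - b) - (1 + a - b) = f - a by ring,
      show 1 + (g - b) - (1 + a - b) = g - a by ring] at key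
    have e1 : ∀ σ : ℂ, ∑' j : ℕ, X (σ + j) * Y (ρ + k) * Q (σ + ρ + (j + k : ℕ)) =
        Y (ρ + k) * ∑' j : ℕ, saalTerm κ (a + (ρ + k)) (f - b) (g - b) (1 + a - b) (σ + j) := by
      intro σ
      rw [← tsum_mul_left]
      refine tsum_congr fun j => ?_
      simp only [hQ, hX, saalTerm]
      rw [show a + (σ + ρ + (j + k : ℕ)) = a + (ρ + k) + (σ + j) by push_cast; ring,
        show a + κ + (σ + ρ + (j + k : ℕ)) = a + (ρ + k) + κ + (σ + j) by push_cast; ring]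
      ring
    rw [e1, e1, ← mul_sub, key, hY, gaussTerm]
    simp only [← add_assoc]
    ring
  have inner2 : ∀ σ : ℂ, 0 < (a + σ).re → 0 < (1 + a - e + σ).re → ∀ j : ℕ,
      ∑' k : ℕ, X (σ + j) * Y (0 + k) * Q (σ + 0 + (j + k : ℕ)) -
        ∑' k : ℕ, X (σ + j) * Y (1 - e + k) * Q (σ + (1 - e) + (j + k : ℕ)) =
      (Sn e / Real.pi * (Gamma κ)⁻¹ * Gamma c * Gamma d * Gamma (1 + c - e) *
        Gamma (1 + d - e)) * (Gamma (f - b + σ + j) * Gamma (g - b + σ + j) *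
          Gamma (a + σ + j) * Gamma (1 + a - e + σ + j) / (Gamma (1 + σ + j) *
            Gamma (1 + a - b + σ + j) * Gamma (1 + a + c - e + σ + j) *
            Gamma (1 + a + d - e + σ + j))) := by
    intro σ ha hb j
    have hc := h.c_pos
    have hd := h.d_pos
    have hj := nn j
    have key := saalschutz_sum_sub' (hy0 (σ + j) (by simp at ha ⊢; linarith))
      (hy1 (σ + j) (by simp at hb ⊢; linarith))
      (show a + (σ + j) + κ - c = 1 + a + d - e + σ + j by rw [hκ]; linear_combination hbal)
      (show a + (σ + j) + κ - d = 1 + a + c - e + σ + j by rw [hκ]; linear_combination hbal)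
      (show 1 + (a + (σ + j)) - e = 1 + a - e + σ + j by ring)
      (by simp at hb ⊢; linarith) (by simp at hb ⊢; linarith)
    have e1 : ∀ ρ : ℂ, ∑' k : ℕ, X (σ + j) * Y (ρ + k) * Q (σ + ρ + (j + k : ℕ)) =
        X (σ + j) * ∑' k : ℕ, saalTerm κ (a + (σ + j)) c d e (ρ + k) := by
      intro ρ
      rw [← tsum_mul_left]
      refine tsum_congr fun k => ?_
      simp only [hQ, hY, saalTerm]
      rw [show a + (σ + ρ + (j + k : ℕ)) = a + (σ + j) + (ρ + k) by push_cast; ring,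
        show a + κ + (σ + ρ + (j + k : ℕ)) = a + (σ + j) + κ + (ρ + k) by push_cast; ring]
      ring
    rw [e1, e1, ← mul_sub, key, hX, gaussTerm]
    simp only [← add_assoc]
    ring
  have i10 := inner1 0 (by simpa using h.a_pos) (by simpa using h.b_pos)
  have i11 := inner1 (1 - e) (by convert h.ae_pos using 2; ring) (by convert h.be_pos using 2; ring)
  have i20 := inner2 0 (by simpa using h.a_pos) (by simpa using h.ae_pos)
  have i21 := inner2 (1 - (1 + a - b)) (by convert h.b_pos using 2; ring)
    (by convert h.be_pos using 2; ring)
  have j10 := (s00.prod_symm.prod.tsum_sub s10.prod_symm.prod).symm.trans (tsum_congr i10)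
  have j11 := (s01.prod_symm.prod.tsum_sub s11.prod_symm.prod).symm.trans (tsum_congr i11)
  have j20 := (s00.prod.tsum_sub s01.prod).symm.trans (tsum_congr i20)
  have j21 := (s10.prod.tsum_sub s11.prod).symm.trans (tsum_congr i21)
  rw [tsum_mul_left] at j10 j11 j20 j21
  have c00 := s00.tsum_comm
  have c10 := s10.tsum_comm
  have c01 := s01.tsum_comm
  have c11 := s11.tsum_comm
  simp only [Function.uncurry, Prod.swap] at j10 j11 j20 j21
  have F0 := Fstar_eq_tsum a b c d e f g
  have F1 := Fstar_eq_tsum' (1 + a - e) (1 + b - e) (1 + c - e) (1 + d - e) (2 - e) (1 + f - e)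
    (1 + g - e)
  have F2 := Fstar_eq_tsum (f - b) (g - b) a (1 + a - e) (1 + a - b) (1 + a + c - e) (1 + a + d - e)
  have F3 := Fstar_eq_tsum' (f - a) (g - a) b (1 + b - e) (1 + b - a) (1 + b + c - e) (1 + b + d - e)
  simp only [add_zero] at j10 j20
  rw [← F0] at j10
  rw [← F2] at j20
  rw [show a + (1 - e) = 1 + a - e by ring, show b + (1 - e) = 1 + b - e by ring,
    show c + (1 - e) = 1 + c - e by ring, show d + (1 - e) = 1 + d - e by ring,
    show 1 + (1 - e) = 2 - e by ring, show e + (1 - e) = 1 by ring,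
    show f + (1 - e) = 1 + f - e by ring, show g + (1 - e) = 1 + g - e by ring,
    ← F1] at j11
  rw [show f - b + (1 - (1 + a - b)) = f - a by ring,
    show g - b + (1 - (1 + a - b)) = g - a by ring, show a + (1 - (1 + a - b)) = b by ring,
    show 1 + a - e + (1 - (1 + a - b)) = 1 + b - e by ring,
    show 1 + (1 - (1 + a - b)) = 1 + b - a by ring,
    show 1 + a - b + (1 - (1 + a - b)) = 1 by ring,
    show 1 + a + c - e + (1 - (1 + a - b)) = 1 + b + c - e by ring,
    show 1 + a + d - e + (1 - (1 + a - b)) = 1 + b + d - e by ring,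
    ← F3] at j21
  simp only [add_zero, Nat.cast_add] at j10 j11 j20 j21 c00 c10 c01 c11
  rw [mul_sub, mul_sub, ← j10, ← j11, ← j20, ← j21, c00, c10, c01, c11]
  ring

/-- The general term of a bilateral series with four upper and four lower parameters. It is an
entire function of the parameters and of the index. -/
def bilTerm (α γ : Fin 4 → ℂ) (s : ℂ) : ℂ :=
  ∏ i, (Gamma (1 - α i - s))⁻¹ * (Gamma (γ i + s))⁻¹

theorem inv_Gamma_eq_mul (s : ℂ) : (Gamma s)⁻¹ = s * (Gamma (s + 1))⁻¹ :=
  one_div_Gamma_eq_self_mul_one_div_Gamma_add_one s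

theorem bilTerm_add_one (α γ : Fin 4 → ℂ) (s : ℂ) :
    bilTerm α γ (s + 1) * ∏ i, (γ i + s) = bilTerm α γ s * ∏ i, (α i + s) := by
  have h : ∏ i, (α i + s) = ∏ i, -(α i + s) := by
    rw [Finset.prod_neg, Finset.card_univ, Fintype.card_fin]
    norm_num
  rw [h, bilTerm, bilTerm, ← Finset.prod_mul_distrib, ← Finset.prod_mul_distrib]
  refine Finset.prod_congr rfl fun i _ => ?_
  rw [inv_Gamma_eq_mul (1 - α i - (s + 1)), inv_Gamma_eq_mul (γ i + s),
    show 1 - α i - (s + 1) + 1 = 1 - α i - s by ring, add_assoc]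
  ring

theorem bilTerm_neg (α γ : Fin 4 → ℂ) (s : ℂ) :
    bilTerm α γ (-s) = bilTerm (fun i => 1 - γ i) (fun i => 1 - α i) s := by
  refine Finset.prod_congr rfl fun i _ => ?_
  rw [mul_comm, show 1 - (1 - γ i) - s = γ i + -s by ring, sub_neg_eq_add]

theorem exists_prod_one_add_bound {ι : Type*} (S : Finset ι) (M : ℝ) :
    ∃ K : ℝ, 0 ≤ K ∧ ∀ a : ι → ℂ, (∀ i, ‖a i‖ ≤ M) → ∀ x : ℂ, ‖x‖ ≤ 1 →
      ‖∏ i ∈ S, (1 + a i * x) - 1 - (∑ i ∈ S, a i) * x‖ ≤ K * ‖x‖ ^ 2 := by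
  classical
  induction S using Finset.induction_on with
  | empty => exact ⟨0, le_rfl, by simp⟩
  | insert j S hj ih =>
    obtain ⟨K, hK0, hK⟩ := ih
    refine ⟨K * (1 + |M|) + |M| * (S.card * |M|), by positivity, fun a ha x hx => ?_⟩
    rw [Finset.prod_insert hj, Finset.sum_insert hj]
    have e : (1 + a j * x) * ∏ i ∈ S, (1 + a i * x) - 1 - (a j + ∑ i ∈ S, a i) * x =
        (∏ i ∈ S, (1 + a i * x) - 1 - (∑ i ∈ S, a i) * x) * (1 + a j * x) +
          a j * (∑ i ∈ S, a i) * x ^ 2 := by ring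
    have haM : ∀ i, ‖a i‖ ≤ |M| := fun i => (ha i).trans (le_abs_self M)
    have h1 : ‖1 + a j * x‖ ≤ 1 + |M| := by
      refine (norm_add_le _ _).trans ?_
      rw [norm_one, norm_mul]
      have := mul_le_mul (haM j) hx (norm_nonneg _) (abs_nonneg M)
      linarith
    have h2 : ‖∑ i ∈ S, a i‖ ≤ S.card * |M| := by
      refine (norm_sum_le _ _).trans ((Finset.sum_le_sum fun i _ => haM i).trans ?_)
      simp
    rw [e]
    refine (norm_add_le _ _).trans ?_
    rw [norm_mul, norm_mul, norm_mul, norm_pow, add_mul]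
    refine add_le_add ?_ ?_
    · calc _ ≤ K * ‖x‖ ^ 2 * (1 + |M|) :=
          mul_le_mul (hK a ha x hx) h1 (norm_nonneg _) (by positivity)
        _ = _ := by ring
    · exact mul_le_mul_of_nonneg_right
        (mul_le_mul (haM j) h2 (norm_nonneg _) (abs_nonneg M)) (by positivity)

theorem half_pow_le_norm_prod {ι : Type*} (S : Finset ι) (a : ι → ℂ) (x : ℂ)
    (h : ∀ i, ‖a i * x‖ ≤ 1 / 2) : (1 / 2 : ℝ) ^ S.card ≤ ‖∏ i ∈ S, (1 + a i * x)‖ := by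
  rw [norm_prod, ← Finset.prod_const]
  refine Finset.prod_le_prod (fun _ _ => by norm_num) fun i _ => ?_
  have h1 := norm_sub_norm_le (1 : ℂ) (-(a i * x))
  rw [sub_neg_eq_add, norm_neg, norm_one] at h1
  linarith [h i]

theorem exists_bilTerm_step_bound (M : ℝ) : ∃ A R : ℝ, 0 ≤ A ∧ 1 ≤ R ∧ M < R ∧
    ∀ α γ : Fin 4 → ℂ, (∀ i, ‖α i‖ ≤ M) → (∀ i, ‖γ i‖ ≤ M) → ∑ i, γ i = ∑ i, α i + 2 →
      ∀ s : ℂ, R ≤ ‖s‖ → ‖bilTerm α γ s * s ^ 2‖ ≤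
        Real.exp (A * (‖s‖ ^ 2)⁻¹) * ‖bilTerm α γ (s + 1) * (s + 1) ^ 2‖ := by
  obtain ⟨K, hK0, hK⟩ := exists_prod_one_add_bound (Finset.univ : Finset (Fin 4 ⊕ Fin 2)) (|M| + 1)
  refine ⟨128 * K, 2 * (|M| + 1), by positivity, by linarith [abs_nonneg M],
    by linarith [abs_nonneg M, le_abs_self M], fun α γ hα hγ hsum s hs => ?_⟩
  have hM := abs_nonneg M
  have hspos : 0 < ‖s‖ := by linarith
  have hs0 : s ≠ 0 := norm_pos_iff.mp hspos
  set x := s⁻¹ with hx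
  have hxn : ‖x‖ = ‖s‖⁻¹ := norm_inv s
  have hx1 : ‖x‖ ≤ 1 := by
    rw [hxn]
    exact inv_le_one_of_one_le₀ (by linarith)
  have hα' : ∀ i : Fin 4 ⊕ Fin 2, ‖Sum.elim α (fun _ => (1 : ℂ)) i‖ ≤ |M| + 1 := by
    rintro (i | i)
    · simpa using (hα i).trans ((le_abs_self M).trans (by linarith))
    · simp
  have hγ' : ∀ i : Fin 4 ⊕ Fin 2, ‖Sum.elim γ (fun _ => (0 : ℂ)) i‖ ≤ |M| + 1 := by
    rintro (i | i)
    · simpa using (hγ i).trans ((le_abs_self M).trans (by linarith))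
    · simp
      linarith
  have h1 := hK _ hα' x hx1
  have h2 := hK _ hγ' x hx1
  have h3 := half_pow_le_norm_prod (Finset.univ : Finset (Fin 4 ⊕ Fin 2))
    (Sum.elim α (fun _ => (1 : ℂ))) x (fun i => by
    rw [norm_mul, hxn]
    calc _ ≤ (|M| + 1) * ‖s‖⁻¹ := mul_le_mul_of_nonneg_right (hα' i) (by positivity)
      _ ≤ 1 / 2 := by
        rw [← div_eq_mul_inv, div_le_div_iff₀ hspos (by norm_num)]
        linarith)
  set Pα := ∏ i : Fin 4 ⊕ Fin 2, (1 + Sum.elim α (fun _ => (1 : ℂ)) i * x) with hPα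
  set Pγ := ∏ i : Fin 4 ⊕ Fin 2, (1 + Sum.elim γ (fun _ => (0 : ℂ)) i * x) with hPγ
  have hcard : (Finset.univ : Finset (Fin 4 ⊕ Fin 2)).card = 6 := by simp
  rw [hcard] at h3
  have hd : ‖Pγ‖ ≤ ‖Pα‖ + 2 * K * ‖x‖ ^ 2 := by
    have e : Pγ = Pα - (Pα - 1 - (∑ i : Fin 4 ⊕ Fin 2, Sum.elim α (fun _ => (1 : ℂ)) i) * x) +
        (Pγ - 1 - (∑ i : Fin 4 ⊕ Fin 2, Sum.elim γ (fun _ => (0 : ℂ)) i) * x) := by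
      have : ∑ i : Fin 4 ⊕ Fin 2, Sum.elim γ (fun _ => (0 : ℂ)) i =
          ∑ i : Fin 4 ⊕ Fin 2, Sum.elim α (fun _ => (1 : ℂ)) i := by
        rw [Fintype.sum_sum_type, Fintype.sum_sum_type]
        simpa using hsum
      rw [this]
      ring
    rw [e]
    refine (norm_add_le _ _).trans ?_
    have := norm_sub_le Pα (Pα - 1 - (∑ i : Fin 4 ⊕ Fin 2, Sum.elim α (fun _ => (1 : ℂ)) i) * x)
    linarith
  have hrec : bilTerm α γ (s + 1) * (s + 1) ^ 2 * Pγ = bilTerm α γ s * s ^ 2 * Pα := by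
    have h := bilTerm_add_one α γ s
    have e1 : ∀ β : Fin 4 → ℂ, ∏ i, (β i + s) = s ^ 4 * ∏ i, (1 + β i * x) := fun β => by
      have : s ^ 4 = ∏ _i : Fin 4, s := by simp
      rw [this, ← Finset.prod_mul_distrib]
      refine Finset.prod_congr rfl fun i _ => ?_
      rw [hx]
      field_simp
      ring
    rw [e1, e1] at h
    rw [hPα, hPγ, Fintype.prod_sum_type, Fintype.prod_sum_type]
    simp only [Sum.elim_inl, Sum.elim_inr, Finset.prod_const, Finset.card_univ, Fintype.card_fin,
      zero_mul, add_zero, one_pow, mul_one, one_mul]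
    have e2 : s + 1 = s * (1 + x) := by
      rw [hx]
      field_simp
    have h' : bilTerm α γ (s + 1) * ∏ i, (1 + γ i * x) = bilTerm α γ s * ∏ i, (1 + α i * x) := by
      apply mul_left_cancel₀ (pow_ne_zero 4 hs0)
      linear_combination h
    rw [e2] at h' ⊢
    linear_combination (s * (1 + x)) ^ 2 * h'
  have hn := congrArg norm hrec
  rw [norm_mul, norm_mul (bilTerm α γ s * s ^ 2)] at hn
  set U := ‖bilTerm α γ s * s ^ 2‖
  set V := ‖bilTerm α γ (s + 1) * (s + 1) ^ 2‖
  have hV : 0 ≤ V := norm_nonneg _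
  have hPpos : 0 < ‖Pα‖ := lt_of_lt_of_le (by norm_num) h3
  have hUV : U ≤ (1 + 128 * K * ‖x‖ ^ 2) * V := by
    refine le_of_mul_le_mul_right ?_ hPpos
    calc U * ‖Pα‖ = V * ‖Pγ‖ := hn.symm
      _ ≤ V * (‖Pα‖ + 2 * K * ‖x‖ ^ 2) := mul_le_mul_of_nonneg_left hd hV
      _ ≤ V * (‖Pα‖ + 2 * K * ‖x‖ ^ 2 * (64 * ‖Pα‖)) := by
        refine mul_le_mul_of_nonneg_left ?_ hV
        have : 1 ≤ 64 * ‖Pα‖ := by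
          norm_num at h3
          linarith
        have := le_mul_of_one_le_right (by positivity : 0 ≤ 2 * K * ‖x‖ ^ 2) this
        linarith
      _ = _ := by ring
  refine hUV.trans (mul_le_mul_of_nonneg_right ?_ hV)
  rw [← inv_pow, ← hxn]
  linarith [Real.add_one_le_exp (128 * K * ‖x‖ ^ 2)]

theorem sq_norm_add_sq_le_sq_norm_add {s : ℂ} (hs : 0 ≤ s.re) (j : ℕ) :
    ‖s‖ ^ 2 + (j : ℝ) ^ 2 ≤ ‖s + j‖ ^ 2 := by
  rw [Complex.sq_norm, Complex.sq_norm, normSq_apply, normSq_apply]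
  simp only [add_re, natCast_re, add_im, natCast_im, add_zero]
  have : 0 ≤ s.re * j := by positivity
  nlinarith

theorem norm_le_norm_add_natCast {s : ℂ} (hs : 0 ≤ s.re) (j : ℕ) : ‖s‖ ≤ ‖s + j‖ := by
  have := sq_norm_add_sq_le_sq_norm_add hs j
  exact le_of_sq_le_sq (by nlinarith [sq_nonneg (j : ℝ)]) (norm_nonneg _)

theorem summable_inv_one_add_sq : Summable fun j : ℕ => (1 + (j : ℝ) ^ 2)⁻¹ := by
  refine Summable.of_nonneg_of_le (fun j => by positivity) (fun j => ?_)
    ((summable_nat_add_iff 1).mpr (Real.summable_nat_pow_inv.mpr one_lt_two) |>.mul_left 2)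
  rw [← one_div, ← one_div, mul_one_div, div_le_div_iff₀ (by positivity) (by positivity)]
  push_cast
  nlinarith [sq_nonneg ((j : ℝ) - 1)]

theorem norm_Sn_add_natCast (x : ℂ) (n : ℕ) : ‖Sn (x + n)‖ = ‖Sn x‖ := by
  rw [Sn, mul_add, mul_comm (Real.pi : ℂ) n, sin_antiperiodic.add_nat_mul_eq, norm_mul]
  simp [Sn]

theorem tendsto_norm_bilTerm {α γ : Fin 4 → ℂ} {s : ℂ} (hsum : ∑ i, γ i = ∑ i, α i + 2)
    (hα : ∀ i, ∀ m : ℕ, α i + s ≠ -m) (hγ : ∀ i, ∀ m : ℕ, γ i + s ≠ -m) :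
    Tendsto (fun N : ℕ => ‖bilTerm α γ (s + N) * (s + N) ^ 2‖) atTop
      (𝓝 (∏ i, (‖Sn (α i + s)‖ / Real.pi))) := by
  have h1 : Tendsto (fun N : ℕ => ∏ i, ((N : ℂ) ^ ((γ i + s) - (α i + s)) *
      (Gamma (α i + s + N) / Gamma (γ i + s + N)))) atTop (𝓝 (∏ _i : Fin 4, 1)) :=
    tendsto_finsetProd _ fun i _ => tendsto_Gamma_ratio _ _ (hα i) (hγ i)
  have h2 : Tendsto (fun N : ℕ => (s + N) / N) atTop (𝓝 1) := by
    have : Tendsto (fun N : ℕ => s * (N : ℂ)⁻¹ + 1) atTop (𝓝 (s * 0 + 1)) :=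
      (tendsto_inv_atTop_nhds_zero_nat.const_mul s).add_const 1
    rw [mul_zero, zero_add] at this
    refine this.congr' ?_
    filter_upwards [eventually_gt_atTop 0] with N hN
    have : (N : ℂ) ≠ 0 := by exact_mod_cast hN.ne'
    field_simp
  have h3 := (h1.norm.mul (h2.norm.pow 2)).mul_const (∏ i, (‖Sn (α i + s)‖ / Real.pi))
  simp only [Finset.prod_const_one, norm_one, one_pow, one_mul] at h3
  refine h3.congr' ?_
  filter_upwards [eventually_gt_atTop 0] with N hN
  have hN0 : (N : ℂ) ≠ 0 := by exact_mod_cast hN.ne'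
  have e1 : ∏ i, (N : ℂ) ^ ((γ i + s) - (α i + s)) = (N : ℂ) ^ 2 := by
    have : ∀ x : Fin 4 → ℂ, ∏ i, (N : ℂ) ^ x i = (N : ℂ) ^ ∑ i, x i := fun x => by
      simp only [Fin.prod_univ_four, Fin.sum_univ_four, cpow_add _ _ hN0]
    rw [this]
    simp only [add_sub_add_right_eq_sub, Finset.sum_sub_distrib, hsum, add_sub_cancel_left]
    norm_cast
  rw [Finset.prod_mul_distrib, e1, bilTerm, norm_mul, norm_mul, norm_pow, norm_pow, norm_div,
    div_pow, norm_prod, norm_prod]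
  have e2 : ∀ i, ‖(Gamma (1 - α i - (s + N)))⁻¹ * (Gamma (γ i + (s + N)))⁻¹‖ =
      ‖Gamma (α i + s + N) / Gamma (γ i + s + N)‖ * (‖Sn (α i + s)‖ / Real.pi) := fun i => by
    have e : 1 - (1 - α i - (s + N)) = α i + s + N := by ring
    rw [inv_Gamma_eq (1 - α i - (s + N)) (by rw [e]; exact Gamma_add_natCast_ne_zero (hα i) N), e,
      ← Sn_one_sub, e, ← add_assoc (γ i), norm_mul, norm_div, norm_div, norm_mul,
      norm_Sn_add_natCast, norm_inv, norm_real, Real.norm_of_nonneg Real.pi_pos.le]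
    ring
  rw [Finset.prod_congr rfl fun i _ => e2 i, Finset.prod_mul_distrib]
  have : ‖(N : ℂ)‖ ≠ 0 := norm_ne_zero_iff.mpr hN0
  field_simp

theorem exists_bilTerm_bound (M : ℝ) : ∃ C R : ℝ, 0 ≤ C ∧ 1 ≤ R ∧ M < R ∧
    ∀ α γ : Fin 4 → ℂ, (∀ i, ‖α i‖ ≤ M) → (∀ i, ‖γ i‖ ≤ M) → ∑ i, γ i = ∑ i, α i + 2 →
      ∀ s : ℂ, 0 ≤ s.re → R ≤ ‖s‖ → ‖bilTerm α γ s‖ * ‖s‖ ^ 2 ≤ C * ∏ i, ‖Sn (α i + s)‖ := by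
  obtain ⟨A, R, hA, hR1, hRM, h⟩ := exists_bilTerm_step_bound M
  set T := ∑' j : ℕ, (1 + (j : ℝ) ^ 2)⁻¹ with hT
  refine ⟨Real.exp (A * T) / Real.pi ^ 4, R, by positivity, hR1, hRM,
    fun α γ hα hγ hsum s hs hsR => ?_⟩
  have hsj : ∀ j : ℕ, R ≤ ‖s + j‖ := fun j => hsR.trans (norm_le_norm_add_natCast hs j)
  have iter : ∀ N : ℕ, ‖bilTerm α γ s * s ^ 2‖ ≤
      Real.exp (A * ∑ j ∈ Finset.range N, (1 + (j : ℝ) ^ 2)⁻¹) *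
        ‖bilTerm α γ (s + N) * (s + N) ^ 2‖ := by
    intro N
    induction N with
    | zero => simp
    | succ N ih =>
      refine ih.trans ?_
      rw [Finset.sum_range_succ, mul_add, Real.exp_add, mul_assoc]
      refine mul_le_mul_of_nonneg_left ?_ (Real.exp_pos _).le
      refine (h α γ hα hγ hsum _ (hsj N)).trans ?_
      rw [Nat.cast_succ, add_assoc s]
      refine mul_le_mul_of_nonneg_right (Real.exp_le_exp.mpr (mul_le_mul_of_nonneg_left ?_ hA))
        (norm_nonneg _)
      refine inv_anti₀ (by positivity) ?_
      have := sq_norm_add_sq_le_sq_norm_add hs N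
      nlinarith
  have hne : ∀ {β : ℂ}, ‖β‖ ≤ M → ∀ m : ℕ, β + s ≠ -m := fun {β} hβ m hm => by
    have : s + m = -β := by linear_combination hm
    have h1 := hsj m
    rw [this, norm_neg] at h1
    linarith
  have lim := (tendsto_norm_bilTerm hsum (fun i => hne (hα i)) fun i => hne (hγ i)).const_mul
    (Real.exp (A * T))
  have key := ge_of_tendsto' lim fun N => (iter N).trans (mul_le_mul_of_nonneg_right
    (Real.exp_le_exp.mpr (mul_le_mul_of_nonneg_left
      (summable_inv_one_add_sq.sum_le_tsum _ fun j _ => by positivity) hA)) (norm_nonneg _))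
  rw [norm_mul, norm_pow, Finset.prod_div_distrib, Finset.prod_const, Finset.card_univ,
    Fintype.card_fin] at key
  rw [div_mul_eq_mul_div]
  rw [← mul_div_assoc] at key
  exact key

theorem norm_Sn_le (x : ℂ) : ‖Sn x‖ ≤ Real.exp (Real.pi * |x.im|) := by
  have h : ∀ y : ℂ, |y.re| ≤ Real.pi * |x.im| → ‖exp y‖ ≤ Real.exp (Real.pi * |x.im|) :=
    fun y hy => by
      rw [norm_exp]
      exact Real.exp_le_exp.mpr ((le_abs_self _).trans hy)
  rw [Sn, sin, norm_div, norm_mul, norm_I, mul_one, norm_ofNat, div_le_iff₀ (by norm_num)]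
  refine (norm_sub_le _ _).trans ?_
  have h1 := h (-(Real.pi * x) * I) (by simp [abs_mul, abs_of_pos Real.pi_pos])
  have h2 := h ((Real.pi * x) * I) (by simp [abs_mul, abs_of_pos Real.pi_pos])
  linarith

theorem exists_bilTerm_bound' (M : ℝ) : ∃ C R : ℝ, 0 ≤ C ∧ 1 ≤ R ∧
    ∀ α γ : Fin 4 → ℂ, (∀ i, ‖α i‖ ≤ M) → (∀ i, ‖γ i‖ ≤ M) → ∑ i, γ i = ∑ i, α i + 2 →
      ∀ s : ℂ, R ≤ ‖s‖ →
        ‖bilTerm α γ s‖ ≤ C * Real.exp (4 * Real.pi * |s.im|) * (‖s‖ ^ 2)⁻¹ := by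
  obtain ⟨C, R, hC, hR, -, h⟩ := exists_bilTerm_bound (|M| + 1)
  refine ⟨C * Real.exp (4 * Real.pi * (|M| + 1)), R, by positivity, hR, ?_⟩
  have key : ∀ α γ : Fin 4 → ℂ, (∀ i, ‖α i‖ ≤ |M| + 1) → (∀ i, ‖γ i‖ ≤ |M| + 1) →
      ∑ i, γ i = ∑ i, α i + 2 → ∀ s : ℂ, 0 ≤ s.re → R ≤ ‖s‖ → ‖bilTerm α γ s‖ ≤
        C * Real.exp (4 * Real.pi * (|M| + 1)) * Real.exp (4 * Real.pi * |s.im|) *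
          (‖s‖ ^ 2)⁻¹ := fun α γ hα hγ hsum s hs hsR => by
    rw [← div_eq_mul_inv, le_div_iff₀ (by positivity [hR.trans hsR])]
    refine (h α γ hα hγ hsum s hs hsR).trans ?_
    rw [mul_assoc, ← Real.exp_add]
    refine mul_le_mul_of_nonneg_left ?_ hC
    have : ∀ i, ‖Sn (α i + s)‖ ≤ Real.exp (Real.pi * (|M| + 1 + |s.im|)) := fun i => by
      refine (norm_Sn_le _).trans (Real.exp_le_exp.mpr (mul_le_mul_of_nonneg_left ?_ Real.pi_pos.le))
      rw [add_im]
      exact (abs_add_le _ _).trans (add_le_add_left ((abs_im_le_norm _).trans (hα i)) _)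
    refine (Finset.prod_le_prod (fun _ _ => norm_nonneg _) fun i _ => this i).trans ?_
    rw [Finset.prod_const, ← Real.exp_nat_mul, Finset.card_univ, Fintype.card_fin]
    refine Real.exp_le_exp.mpr (le_of_eq ?_)
    push_cast
    ring
  intro α γ hα hγ hsum s hsR
  have hM := le_abs_self M
  rcases le_total 0 s.re with hs | hs
  · exact key α γ (fun i => (hα i).trans (by linarith)) (fun i => (hγ i).trans (by linarith))
      hsum s hs hsR
  · have hb : ∀ β : ℂ, ‖β‖ ≤ M → ‖1 - β‖ ≤ |M| + 1 := fun β hβ => by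
      refine (norm_sub_le _ _).trans ?_
      rw [norm_one]
      linarith
    have := key (fun i => 1 - γ i) (fun i => 1 - α i) (fun i => hb _ (hγ i)) (fun i => hb _ (hα i))
      (by simp only [Finset.sum_sub_distrib]; linear_combination hsum) (-s) (by simpa)
      (by rwa [norm_neg])
    rwa [← bilTerm_neg, neg_neg, norm_neg, neg_im, abs_neg] at this

theorem differentiable_bilTerm {α γ : ℂ → Fin 4 → ℂ} (hα : ∀ i, Differentiable ℂ fun z => α z i)
    (hγ : ∀ i, Differentiable ℂ fun z => γ z i) {s : ℂ → ℂ} (hs : Differentiable ℂ s) :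
    Differentiable ℂ fun z => bilTerm (α z) (γ z) (s z) := by
  have h : ∀ {f : ℂ → ℂ}, Differentiable ℂ f → Differentiable ℂ fun z => (Gamma (f z))⁻¹ :=
    fun hf => differentiable_one_div_Gamma.comp hf
  unfold bilTerm
  refine Differentiable.fun_finsetProd fun i _ => (h ?_).mul (h ?_)
  · exact ((differentiable_const _).sub (hα i)).sub hs
  · exact (hγ i).add hs

/-- The bilateral series with general term `bilTerm`. -/
def bilSum (α γ : Fin 4 → ℂ) : ℂ := ∑' n : ℤ, bilTerm α γ n

theorem exists_summable_bound_bilTerm {α γ : ℂ → Fin 4 → ℂ}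
    (hα : ∀ i, Differentiable ℂ fun z => α z i) (hγ : ∀ i, Differentiable ℂ fun z => γ z i)
    (hsum : ∀ z, ∑ i, γ z i = ∑ i, α z i + 2) (r : ℝ) :
    ∃ u : ℤ → ℝ, Summable u ∧ ∀ n : ℤ, ∀ z ∈ Metric.closedBall (0 : ℂ) r,
      ‖bilTerm (α z) (γ z) n‖ ≤ u n := by
  have hK : IsCompact (Metric.closedBall (0 : ℂ) r) := isCompact_closedBall _ _
  choose Mα hMα using fun i => hK.exists_bound_of_continuousOn (hα i).continuous.continuousOn
  choose Mγ hMγ using fun i => hK.exists_bound_of_continuousOn (hγ i).continuous.continuousOn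
  choose B hB using fun n : ℤ => hK.exists_bound_of_continuousOn
    (differentiable_bilTerm hα hγ (differentiable_const (n : ℂ))).continuous.continuousOn
  obtain ⟨C, R, hC, hR, h⟩ := exists_bilTerm_bound' (∑ i, |Mα i| + ∑ i, |Mγ i|)
  have hle : ∀ (N : Fin 4 → ℝ) i, N i ≤ ∑ i, |N i| := fun N i => (le_abs_self _).trans
    (Finset.single_le_sum (f := fun i => |N i|) (fun _ _ => abs_nonneg _) (Finset.mem_univ i))
  have h0 : ∀ N : Fin 4 → ℝ, 0 ≤ ∑ i, |N i| := fun N => Finset.sum_nonneg fun _ _ => abs_nonneg _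
  have hC2 : Summable fun n : ℤ => C * (‖(n : ℂ)‖ ^ 2)⁻¹ := by
    refine Summable.mul_left _ ((Real.summable_one_div_int_pow.mpr one_lt_two).congr fun n => ?_)
    simp
  refine ⟨fun n => if R ≤ ‖(n : ℂ)‖ then C * (‖(n : ℂ)‖ ^ 2)⁻¹ else B n,
    hC2.congr_cofinite ?_, fun n z hz => ?_⟩
  · have : {n : ℤ | ‖(n : ℂ)‖ < R}.Finite := by
      refine (Set.finite_Icc (-⌈R⌉) ⌈R⌉).subset fun n hn => ?_
      simp only [Set.mem_ofPred_eq, norm_intCast, abs_lt] at hn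
      have := Int.le_ceil R
      exact ⟨by exact_mod_cast (by push_cast; linarith : ((-⌈R⌉ : ℤ) : ℝ) ≤ n),
        by exact_mod_cast (by linarith : (n : ℝ) ≤ ⌈R⌉)⟩
    filter_upwards [this.compl_mem_cofinite] with n hn
    rw [if_pos (not_lt.mp fun hlt => hn hlt)]
  · dsimp only
    split_ifs with hn
    · have := h (α z) (γ z) (fun i => (hMα i z hz).trans ((hle _ i).trans
        (le_add_of_nonneg_right (h0 _)))) (fun i => (hMγ i z hz).trans ((hle _ i).trans
        (le_add_of_nonneg_left (h0 _)))) (hsum z) n hn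
      simpa using this
    · exact hB n z hz

theorem differentiable_bilSum {α γ : ℂ → Fin 4 → ℂ}
    (hα : ∀ i, Differentiable ℂ fun z => α z i) (hγ : ∀ i, Differentiable ℂ fun z => γ z i)
    (hsum : ∀ z, ∑ i, γ z i = ∑ i, α z i + 2) :
    Differentiable ℂ fun z => bilSum (α z) (γ z) := by
  intro z
  obtain ⟨u, hu, h⟩ := exists_summable_bound_bilTerm hα hγ hsum (‖z‖ + 1)
  have := differentiableOn_tsum_of_summable_norm hu (F := fun (n : ℤ) z => bilTerm (α z) (γ z) n)
    (fun n => (differentiable_bilTerm hα hγ (differentiable_const (n : ℂ))).differentiableOn)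
    (Metric.isOpen_ball (x := (0 : ℂ)) (ε := ‖z‖ + 1))
    fun n w hw => h n w (Metric.ball_subset_closedBall hw)
  exact this.differentiableAt (Metric.isOpen_ball.mem_nhds (by simp))

theorem eq_sum_range_of_norm_le_pow {U : ℂ → ℂ} (hU : Differentiable ℂ U) (N : ℕ)
    (h : ∀ ε > 0, ∃ R : ℝ, ∀ q : ℂ, R ≤ ‖q‖ → ‖U q‖ ≤ ε * ‖q‖ ^ N) (q : ℂ) :
    U q = ∑ n ∈ Finset.range N, (n.factorial : ℂ)⁻¹ * iteratedDeriv n U 0 * q ^ n := by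
  have h0 : ∀ n, N ≤ n → iteratedDeriv n U 0 = 0 := fun n hn => by
    rw [← norm_le_zero_iff]
    refine le_of_forall_pos_le_add fun ε hε => ?_
    obtain ⟨R, hR⟩ := h (ε / n.factorial) (by positivity)
    set r := max R 1
    have hr : 1 ≤ r := le_max_right _ _
    have := norm_iteratedDeriv_le_of_forall_mem_sphere_norm_le n (by linarith : 0 < r)
      (hU.diffContOnCl (s := Metric.ball 0 r)) (C := ε / n.factorial * r ^ N) fun z hz => by
        have hz' : ‖z‖ = r := by simpa using hz
        have := hR z (by rw [hz']; exact le_max_left _ _)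
        rwa [hz'] at this
    refine this.trans ?_
    rw [div_le_iff₀ (by positivity), zero_add, ← mul_assoc, mul_div_cancel₀ _ (by positivity)]
    exact mul_le_mul_of_nonneg_left (pow_le_pow_right₀ hr hn) hε.le
  rw [← Complex.taylorSeries_eq_of_entire' 0 q hU, sub_zero]
  refine tsum_eq_sum fun n hn => ?_
  rw [h0 n (by simpa using hn)]
  ring

theorem exists_trig_of_periodic {f : ℂ → ℂ} (hf : Differentiable ℂ f) (hp : f.Periodic 1)
    {g : ℝ → ℝ} (hg : Tendsto g atTop (𝓝 0)) (hfg : ∀ᶠ η in atTop, ∀ y : ℂ, |y.im| = η →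
      ‖f y‖ ≤ Real.exp (4 * Real.pi * η) * g η) :
    ∃ c₁ c₂ c₃ : ℂ, ∀ y, f y = c₁ * exp (-(2 * Real.pi * I * y)) + c₂ +
      c₃ * exp (2 * Real.pi * I * y) := by
  set F : ℂ → ℂ := fun y => f y * exp (4 * Real.pi * I * y) with hF
  have hFd : Differentiable ℂ F := by fun_prop
  have hFp : F.Periodic ((1 : ℝ) : ℂ) := fun y => by
    simp only [hF, ofReal_one]
    rw [hp y, mul_add, exp_add, show (4 * Real.pi * I * 1 : ℂ) = (2 : ℕ) * (2 * Real.pi * I) by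
      push_cast; ring, exp_nat_mul_two_pi_mul_I, mul_one]
  have hFn : ∀ y, ‖F y‖ = ‖f y‖ * Real.exp (-(4 * Real.pi * y.im)) := fun y => by
    rw [hF, norm_mul, norm_exp]
    simp
  have hzero : Filter.ZeroAtFilter (comap im atTop) F := by
    have h1 : Tendsto (fun y : ℂ => g y.im) (comap im atTop) (𝓝 0) := hg.comp tendsto_comap
    refine squeeze_zero_norm' ?_ h1
    filter_upwards [tendsto_comap.eventually hfg, tendsto_comap.eventually (eventually_ge_atTop 0)]
      with y hy hy0
    rw [hFn]
    refine (mul_le_mul_of_nonneg_right (hy y (abs_of_nonneg hy0)) (Real.exp_pos _).le).trans ?_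
    rw [mul_right_comm, ← Real.exp_add]
    simp
  set U := Function.Periodic.cuspFunction 1 F
  have hUF : ∀ y, U (Function.Periodic.qParam 1 y) = F y :=
    Function.Periodic.eq_cuspFunction one_ne_zero hFp
  have hU0 : U 0 = 0 := Function.Periodic.cuspFunction_zero_of_zero_at_inf one_pos hzero
  have hU : Differentiable ℂ U := fun q => by
    by_cases hq : q = 0
    · rw [hq]
      exact Function.Periodic.differentiableAt_cuspFunction_zero one_pos hFp
        (Eventually.of_forall hFd) hzero.boundedAtFilter
    · rw [← Function.Periodic.qParam_right_inv one_ne_zero hq]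
      exact Function.Periodic.differentiableAt_cuspFunction one_ne_zero hFp (hFd _)
  have key := eq_sum_range_of_norm_le_pow hU 4 fun ε hε => by
    obtain ⟨η, hη⟩ := eventually_atTop.mp (hfg.and (hg.eventually_le_const hε))
    refine ⟨Real.exp (2 * Real.pi * max η 0), fun q hq => ?_⟩
    have hq0 : q ≠ 0 := norm_pos_iff.mp ((Real.exp_pos _).trans_le hq)
    obtain ⟨y, rfl⟩ : ∃ y, Function.Periodic.qParam 1 y = q :=
      ⟨_, Function.Periodic.qParam_right_inv one_ne_zero hq0⟩
    rw [Function.Periodic.norm_qParam] at hq ⊢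
    rw [hUF, hFn]
    have h1 : 2 * Real.pi * max η 0 ≤ 2 * Real.pi * -y.im := by
      have := Real.exp_le_exp.mp hq
      linarith
    have h2 : max η 0 ≤ -y.im := le_of_mul_le_mul_left h1 (by positivity)
    obtain ⟨h3, h4⟩ := hη (-y.im) ((le_max_left _ _).trans h2)
    have h5 := h3 y (abs_of_nonpos (by linarith [le_max_right η 0]))
    rw [← Real.exp_nat_mul, mul_comm ε]
    refine (mul_le_mul_of_nonneg_right h5 (Real.exp_pos _).le).trans ?_
    rw [mul_right_comm, ← Real.exp_add]
    refine (mul_le_mul_of_nonneg_left h4 (Real.exp_pos _).le).trans (le_of_eq ?_)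
    congr 2
    push_cast
    ring
  simp only [Finset.sum_range_succ, Finset.sum_range_zero] at key
  refine ⟨(Nat.factorial 1 : ℂ)⁻¹ * iteratedDeriv 1 U 0, (Nat.factorial 2 : ℂ)⁻¹ *
    iteratedDeriv 2 U 0, (Nat.factorial 3 : ℂ)⁻¹ * iteratedDeriv 3 U 0, fun y => ?_⟩
  have h1 := key (Function.Periodic.qParam 1 y)
  have hE : Function.Periodic.qParam 1 y = exp (2 * Real.pi * I * y) := by
    simp [Function.Periodic.qParam]
  have hE4 : exp (4 * Real.pi * I * y) = exp (2 * Real.pi * I * y) ^ 2 := by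
    rw [← exp_nat_mul]
    congr 1
    push_cast
    ring
  rw [hUF, hE] at h1
  simp only [hF, hE4] at h1
  rw [iteratedDeriv_zero, hU0] at h1
  rw [exp_neg]
  have := exp_ne_zero (2 * Real.pi * I * y)
  apply mul_right_cancel₀ (pow_ne_zero 2 this)
  rw [h1]
  field_simp
  ring

theorem bilTerm_add_right (α γ : Fin 4 → ℂ) (s y : ℂ) :
    bilTerm (fun i => α i + y) (fun i => γ i + y) s = bilTerm α γ (s + y) := by
  refine Finset.prod_congr rfl fun i _ => ?_
  rw [show 1 - (α i + y) - s = 1 - α i - (s + y) by ring,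
    show γ i + y + s = γ i + (s + y) by ring]

/-- The bilateral series with all parameters shifted by the same amount. -/
def bilShift (α γ : Fin 4 → ℂ) (y : ℂ) : ℂ := bilSum (fun i => α i + y) (fun i => γ i + y)

theorem bilShift_eq (α γ : Fin 4 → ℂ) (y : ℂ) :
    bilShift α γ y = ∑' n : ℤ, bilTerm α γ (n + y) :=
  tsum_congr fun n => bilTerm_add_right α γ n y

theorem differentiable_bilShift {α γ : Fin 4 → ℂ} (hsum : ∑ i, γ i = ∑ i, α i + 2) :
    Differentiable ℂ (bilShift α γ) := by
  refine differentiable_bilSum (fun i => by fun_prop) (fun i => by fun_prop) fun z => ?_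
  simp only [Finset.sum_add_distrib]
  linear_combination hsum

theorem bilShift_periodic (α γ : Fin 4 → ℂ) : (bilShift α γ).Periodic 1 := fun y => by
  rw [bilShift_eq, bilShift_eq, ← (Equiv.addRight (1 : ℤ)).tsum_eq fun n : ℤ => bilTerm α γ (n + y)]
  refine tsum_congr fun n => ?_
  simp [add_comm, add_left_comm]

theorem summable_two_mul_inv_sq_add {η : ℝ} (hη : 1 ≤ η) :
    Summable fun n : ℤ => 2 * ((n : ℝ) ^ 2 + η ^ 2)⁻¹ := by
  refine Summable.mul_left _ (Summable.of_norm_bounded_eventually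
    (Real.summable_one_div_int_pow.mpr one_lt_two) ?_)
  filter_upwards [(Set.finite_singleton (0 : ℤ)).compl_mem_cofinite] with n hn
  have hn0 : (n : ℝ) ≠ 0 := by exact_mod_cast hn
  rw [Real.norm_of_nonneg (by positivity), one_div]
  exact inv_anti₀ (by positivity) (le_add_of_nonneg_right (sq_nonneg _))

theorem tendsto_tsum_two_mul_inv_sq_add :
    Tendsto (fun η : ℝ => ∑' n : ℤ, 2 * ((n : ℝ) ^ 2 + η ^ 2)⁻¹) atTop (𝓝 0) := by
  have : Tendsto (fun η : ℝ => ∑' n : ℤ, 2 * ((n : ℝ) ^ 2 + η ^ 2)⁻¹) atTop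
      (𝓝 (∑' _n : ℤ, (0 : ℝ))) := by
    refine tendsto_tsum_of_dominated_convergence (summable_two_mul_inv_sq_add le_rfl)
      (fun n => ?_) ?_
    · have h : Tendsto (fun η : ℝ => (n : ℝ) ^ 2 + η ^ 2) atTop atTop :=
        tendsto_atTop_add_const_left _ _ (tendsto_pow_atTop two_ne_zero)
      simpa using h.inv_tendsto_atTop.const_mul 2
    · filter_upwards [eventually_ge_atTop 1] with η hη n
      rw [Real.norm_of_nonneg (by positivity)]
      refine mul_le_mul_of_nonneg_left (inv_anti₀ (by positivity) ?_) zero_le_two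
      have := pow_le_pow_left₀ zero_le_one hη 2
      linarith
  simpa using this

theorem exists_bilShift_bound {α γ : Fin 4 → ℂ} (hsum : ∑ i, γ i = ∑ i, α i + 2) :
    ∃ C : ℝ, ∀ᶠ η in atTop, ∀ y : ℂ, |y.im| = η → ‖bilShift α γ y‖ ≤
      Real.exp (4 * Real.pi * η) * (C * ∑' n : ℤ, 2 * ((n : ℝ) ^ 2 + η ^ 2)⁻¹) := by
  obtain ⟨C, R, hC, hR, h⟩ := exists_bilTerm_bound' (∑ i, ‖α i‖ + ∑ i, ‖γ i‖)
  refine ⟨C, ?_⟩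
  have hle : ∀ (N : Fin 4 → ℂ) i, ‖N i‖ ≤ ∑ i, ‖N i‖ := fun N i =>
    Finset.single_le_sum (f := fun i => ‖N i‖) (fun _ _ => norm_nonneg _) (Finset.mem_univ i)
  have h0 : ∀ N : Fin 4 → ℂ, 0 ≤ ∑ i, ‖N i‖ := fun N => Finset.sum_nonneg fun _ _ => norm_nonneg _
  filter_upwards [eventually_ge_atTop R, eventually_ge_atTop 2] with η hηR hη2 y hy
  have hper : bilShift α γ y = bilShift α γ (y - ⌊y.re⌋) := by
    simpa using ((bilShift_periodic α γ).sub_int_mul_eq (x := y) ⌊y.re⌋).symm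
  rw [hper, bilShift_eq, ← mul_assoc, mul_comm (Real.exp _)]
  refine tsum_of_norm_bounded ((summable_two_mul_inv_sq_add (by linarith)).hasSum.mul_left _)
    fun n => ?_
  set s := (n : ℂ) + (y - ⌊y.re⌋) with hs
  have him : s.im = y.im := by simp [hs]
  have hre : s.re = n + Int.fract y.re := by simp [hs, ← Int.self_sub_floor]
  have hη : η ≤ ‖s‖ := by
    rw [← hy, ← him]
    exact abs_im_le_norm s
  refine (h α γ (fun i => (hle α i).trans (le_add_of_nonneg_right (h0 _)))
    (fun i => (hle γ i).trans (le_add_of_nonneg_left (h0 _))) hsum s (hηR.trans hη)).trans ?_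
  have hs0 : 0 < ‖s‖ := by linarith
  rw [him, hy]
  refine mul_le_mul_of_nonneg_left ?_ (by positivity)
  rw [← div_eq_mul_inv, le_div_iff₀ (by positivity), inv_mul_le_iff₀ (by positivity),
    Complex.sq_norm, normSq_apply, hre, him, ← pow_two y.im, ← sq_abs y.im, hy]
  have h1 := Int.fract_nonneg y.re
  have h2 := (Int.fract_lt_one y.re).le
  nlinarith [sq_nonneg ((n : ℝ) + 2 * Int.fract y.re)]

/-- A Saalschützian bilateral series, as a function of a common shift of its parameters, is a
trigonometric polynomial of degree one. -/
theorem exists_bilShift_eq {α γ : Fin 4 → ℂ} (hsum : ∑ i, γ i = ∑ i, α i + 2) :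
    ∃ c₁ c₂ c₃ : ℂ, ∀ y, bilShift α γ y = c₁ * exp (-(2 * Real.pi * I * y)) + c₂ +
      c₃ * exp (2 * Real.pi * I * y) := by
  obtain ⟨C, hC⟩ := exists_bilShift_bound hsum
  refine exists_trig_of_periodic (differentiable_bilShift hsum) (bilShift_periodic α γ) ?_ hC
  simpa using tendsto_tsum_two_mul_inv_sq_add.const_mul C

theorem Sn_eq_zero_iff {x : ℂ} : Sn x = 0 ↔ ∃ n : ℤ, x = n := by
  rw [Sn, sin_eq_zero_iff]
  refine exists_congr fun n => ?_
  have : (Real.pi : ℂ) ≠ 0 := ofReal_ne_zero.mpr Real.pi_ne_zero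
  rw [mul_comm, mul_left_inj' this]

theorem ne_neg_natCast_of_Sn_ne_zero {x : ℂ} (hx : Sn x ≠ 0) (m : ℕ) : x ≠ -m := fun h =>
  hx (Sn_eq_zero_iff.mpr ⟨-m, by rw [h]; push_cast; rfl⟩)

theorem Gamma_ne_zero_of_Sn_ne_zero {x : ℂ} (hx : Sn x ≠ 0) : Gamma x ≠ 0 :=
  Gamma_ne_zero (ne_neg_natCast_of_Sn_ne_zero hx)

theorem Sn_add_natCast (x : ℂ) (n : ℕ) : Sn (x + n) = (-1) ^ n * Sn x := by
  rw [Sn, mul_add, mul_comm (Real.pi : ℂ) n, sin_antiperiodic.add_nat_mul_eq]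
  simp [Sn]

/-- A unilateral series as a bilateral series with a lower parameter equal to one. -/
theorem Fstar_eq_bilSum {a b c d : ℂ} (ha : Sn a ≠ 0) (hb : Sn b ≠ 0) (hc : Sn c ≠ 0)
    (hd : Sn d ≠ 0) (e f g : ℂ) : Fstar a b c d e f g =
      Real.pi ^ 4 * bilSum ![a, b, c, d] ![1, e, f, g] / (Sn a * Sn b * Sn c * Sn d) := by
  have hpi : (Real.pi : ℂ) ≠ 0 := ofReal_ne_zero.mpr Real.pi_ne_zero
  have hsupp : Function.support (fun n : ℤ => bilTerm ![a, b, c, d] ![1, e, f, g] n) ⊆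
      Set.range ((↑) : ℕ → ℤ) := fun n hn => by
    by_contra h
    refine hn ?_
    obtain ⟨m, rfl⟩ : ∃ m : ℕ, n = -(m + 1) := by
      rcases Int.eq_nat_or_neg n with ⟨m, rfl | rfl⟩
      · exact absurd ⟨m, rfl⟩ h
      · rcases m with _ | m
        · exact absurd ⟨0, by simp⟩ h
        · exact ⟨m, by push_cast; rfl⟩
    have : Gamma (1 + ((-(m + 1) : ℤ) : ℂ)) = 0 := by
      rw [Gamma_eq_zero_iff]
      exact ⟨m, by push_cast; ring⟩
    simp only [bilTerm, Fin.prod_univ_four, Matrix.cons_val_zero, this]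
    simp
  rw [bilSum, ← Nat.cast_injective.tsum_eq hsupp, Fstar_eq_tsum, ← tsum_mul_left, ← tsum_div_const]
  refine tsum_congr fun k => ?_
  have key : ∀ {x : ℂ}, Sn x ≠ 0 → (Gamma (1 - x - k))⁻¹ =
      Gamma (x + k) * ((-1) ^ k * Sn x) / Real.pi := fun {x} hx => by
    have e1 : 1 - (1 - x - k) = x + k := by ring
    rw [inv_Gamma_eq _ (by
      rw [e1]
      exact Gamma_add_natCast_ne_zero (ne_neg_natCast_of_Sn_ne_zero hx) k), e1, ← Sn_one_sub, e1,
      Sn_add_natCast]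
  have hsign : ((-1 : ℂ) ^ k) ^ 4 = 1 := by
    rw [← pow_mul, mul_comm, pow_mul]
    norm_num
  simp only [bilTerm, Fin.prod_univ_four, Matrix.cons_val_zero, Matrix.cons_val_one,
    Matrix.cons_val, Int.cast_natCast]
  rw [key ha, key hb, key hc, key hd, eq_div_iff (by simp [ha, hb, hc, hd]), div_eq_mul_inv,
    mul_inv, mul_inv, mul_inv]
  field_simp
  linear_combination (-(Gamma (1 + k))⁻¹ * (Gamma (e + k))⁻¹ * (Gamma (f + k))⁻¹ *
    (Gamma (g + k))⁻¹ * Gamma (a + k) * Gamma (b + k) * Gamma (c + k) * Gamma (d + k)) * hsign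

theorem bilSum_reverse (α γ : Fin 4 → ℂ) :
    bilSum α γ = bilSum (fun i => 1 - γ i) (fun i => 1 - α i) := by
  rw [bilSum, ← (Equiv.neg ℤ).tsum_eq]
  refine tsum_congr fun n => ?_
  rw [Equiv.neg_apply, Int.cast_neg, bilTerm_neg]

/-- The difference of the two sides of the two-term transformation of `Lf`, multiplied by a
trigonometric factor which makes it an entire function of the parameters. -/
def transformDefect (a b c d e f g : ℂ) : ℂ :=
  Sn (1 + a - b) * ((Gamma c)⁻¹ * (Gamma d)⁻¹ * (Gamma (1 + c - e))⁻¹ * (Gamma (1 + d - e))⁻¹) *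
      (Sn (f - b) * Sn (g - b) * Sn (f - a) * Sn (g - a)) *
      (Sn (1 + a - e) * Sn (1 + b - e) * Sn (1 + c - e) * Sn (1 + d - e) *
          bilSum ![a, b, c, d] ![1, e, f, g] -
        Sn a * Sn b * Sn c * Sn d * bilSum ![1 + a - e, 1 + b - e, 1 + c - e, 1 + d - e]
          ![1, 2 - e, 1 + f - e, 1 + g - e]) -
    Sn e * ((Gamma (f - b))⁻¹ * (Gamma (g - b))⁻¹ * (Gamma (f - a))⁻¹ * (Gamma (g - a))⁻¹) *
      (Sn c * Sn d * Sn (1 + c - e) * Sn (1 + d - e)) *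
      (Sn (f - a) * Sn (g - a) * Sn b * Sn (1 + b - e) *
          bilSum ![f - b, g - b, a, 1 + a - e] ![1, 1 + a - b, 1 + a + c - e, 1 + a + d - e] -
        Sn (f - b) * Sn (g - b) * Sn a * Sn (1 + a - e) *
          bilSum ![f - a, g - a, b, 1 + b - e] ![1, 1 + b - a, 1 + b + c - e, 1 + b + d - e])

theorem transformDefect_eq {a b c d e f g : ℂ} (ha : Sn a ≠ 0) (hb : Sn b ≠ 0) (hc : Sn c ≠ 0)
    (hd : Sn d ≠ 0) (hae : Sn (1 + a - e) ≠ 0) (hbe : Sn (1 + b - e) ≠ 0)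
    (hce : Sn (1 + c - e) ≠ 0) (hde : Sn (1 + d - e) ≠ 0) (hfa : Sn (f - a) ≠ 0)
    (hfb : Sn (f - b) ≠ 0) (hga : Sn (g - a) ≠ 0) (hgb : Sn (g - b) ≠ 0) :
    transformDefect a b c d e f g =
      (Sn a * Sn b * Sn c * Sn d * Sn (1 + a - e) * Sn (1 + b - e) * Sn (1 + c - e) *
        Sn (1 + d - e) * (Sn (f - b) * Sn (g - b) * Sn (f - a) * Sn (g - a))) / Real.pi ^ 4 /
      (Gamma c * Gamma d * Gamma (1 + c - e) * Gamma (1 + d - e) *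
        (Gamma (f - b) * Gamma (g - b) * Gamma (f - a) * Gamma (g - a))) *
      (Sn (1 + a - b) * Gamma (f - b) * Gamma (g - b) * Gamma (f - a) * Gamma (g - a) *
        (Fstar a b c d e f g - Fstar (1 + a - e) (1 + b - e) (1 + c - e) (1 + d - e)
          (2 - e) (1 + f - e) (1 + g - e)) -
      Sn e * Gamma c * Gamma d * Gamma (1 + c - e) * Gamma (1 + d - e) *
        (Fstar (f - b) (g - b) a (1 + a - e) (1 + a - b) (1 + a + c - e) (1 + a + d - e) -
          Fstar (f - a) (g - a) b (1 + b - e) (1 + b - a) (1 + b + c - e) (1 + b + d - e))) := by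
  have hpi : (Real.pi : ℂ) ≠ 0 := ofReal_ne_zero.mpr Real.pi_ne_zero
  have gc := Gamma_ne_zero_of_Sn_ne_zero hc
  have gd := Gamma_ne_zero_of_Sn_ne_zero hd
  have gce := Gamma_ne_zero_of_Sn_ne_zero hce
  have gde := Gamma_ne_zero_of_Sn_ne_zero hde
  have gfa := Gamma_ne_zero_of_Sn_ne_zero hfa
  have gfb := Gamma_ne_zero_of_Sn_ne_zero hfb
  have gga := Gamma_ne_zero_of_Sn_ne_zero hga
  have ggb := Gamma_ne_zero_of_Sn_ne_zero hgb
  rw [Fstar_eq_bilSum ha hb hc hd, Fstar_eq_bilSum hae hbe hce hde, Fstar_eq_bilSum hfb hgb ha hae,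
    Fstar_eq_bilSum hfa hga hb hbe, transformDefect]
  generalize bilSum ![a, b, c, d] _ = X1
  generalize bilSum ![1 + a - e, 1 + b - e, 1 + c - e, 1 + d - e] _ = X2
  generalize bilSum ![f - b, g - b, a, 1 + a - e] _ = X3
  generalize bilSum ![f - a, g - a, b, 1 + b - e] _ = X4
  generalize Gamma c = g1 at *
  generalize Gamma d = g2 at *
  generalize Gamma (1 + c - e) = g3 at *
  generalize Gamma (1 + d - e) = g4 at *
  generalize Gamma (f - b) = g5 at *
  generalize Gamma (g - b) = g6 at *
  generalize Gamma (f - a) = g7 at *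
  generalize Gamma (g - a) = g8 at *
  generalize Sn a = s1 at *
  generalize Sn b = s2 at *
  generalize Sn c = s3 at *
  generalize Sn d = s4 at *
  generalize Sn (1 + a - e) = s5 at *
  generalize Sn (1 + b - e) = s6 at *
  generalize Sn (1 + c - e) = s7 at *
  generalize Sn (1 + d - e) = s8 at *
  generalize Sn (f - b) = t1 at *
  generalize Sn (g - b) = t2 at *
  generalize Sn (f - a) = t3 at *
  generalize Sn (g - a) = t4 at *
  generalize Sn (1 + a - b) = t5 at *
  generalize Sn e = t6 at *
  have e1 : Real.pi ^ 4 * X1 / (s1 * s2 * s3 * s4) - Real.pi ^ 4 * X2 / (s5 * s6 * s7 * s8) =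
      Real.pi ^ 4 * (s5 * s6 * s7 * s8 * X1 - s1 * s2 * s3 * s4 * X2) /
        (s1 * s2 * s3 * s4 * (s5 * s6 * s7 * s8)) := by
    field_simp
  have e2 : Real.pi ^ 4 * X3 / (t1 * t2 * s1 * s5) - Real.pi ^ 4 * X4 / (t3 * t4 * s2 * s6) =
      Real.pi ^ 4 * (t3 * t4 * s2 * s6 * X3 - t1 * t2 * s1 * s5 * X4) /
        (t1 * t2 * s1 * s5 * (t3 * t4 * s2 * s6)) := by
    field_simp
  rw [e1, e2]
  generalize s5 * s6 * s7 * s8 * X1 - s1 * s2 * s3 * s4 * X2 = Y1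
  generalize t3 * t4 * s2 * s6 * X3 - t1 * t2 * s1 * s5 * X4 = Y2
  rw [mul_sub]
  congr 1 <;> field_simp

theorem differentiable_Sn {u : ℂ → ℂ} (hu : Differentiable ℂ u) :
    Differentiable ℂ fun z => Sn (u z) := by
  unfold Sn
  fun_prop

theorem differentiable_inv_Gamma_comp {u : ℂ → ℂ} (hu : Differentiable ℂ u) :
    Differentiable ℂ fun z => (Gamma (u z))⁻¹ :=
  differentiable_one_div_Gamma.comp hu

theorem differentiable_bilSum_vec {a b c d e f g : ℂ → ℂ} (ha : Differentiable ℂ a)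
    (hb : Differentiable ℂ b) (hc : Differentiable ℂ c) (hd : Differentiable ℂ d)
    (he : Differentiable ℂ e) (hf : Differentiable ℂ f) (hg : Differentiable ℂ g)
    (hbal : ∀ z, e z + f z + g z = a z + b z + c z + d z + 1) :
    Differentiable ℂ fun z => bilSum ![a z, b z, c z, d z] ![1, e z, f z, g z] := by
  refine differentiable_bilSum (fun i => ?_) (fun i => ?_) fun z => ?_
  · fin_cases i <;> assumption
  · fin_cases i
    · exact differentiable_const 1
    all_goals assumption
  · simp only [Fin.sum_univ_four, Matrix.cons_val]
    linear_combination hbal z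

theorem differentiable_transformDefect {a b c d e f g : ℂ → ℂ} (ha : Differentiable ℂ a)
    (hb : Differentiable ℂ b) (hc : Differentiable ℂ c) (hd : Differentiable ℂ d)
    (he : Differentiable ℂ e) (hf : Differentiable ℂ f) (hg : Differentiable ℂ g)
    (hbal : ∀ z, e z + f z + g z = a z + b z + c z + d z + 1) :
    Differentiable ℂ fun z => transformDefect (a z) (b z) (c z) (d z) (e z) (f z) (g z) := by
  unfold transformDefect
  have S := fun {u : ℂ → ℂ} (hu : Differentiable ℂ u) => differentiable_Sn hu
  have G := fun {u : ℂ → ℂ} (hu : Differentiable ℂ u) => differentiable_inv_Gamma_comp hu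
  have B1 := differentiable_bilSum_vec ha hb hc hd he hf hg hbal
  have B2 := differentiable_bilSum_vec ((ha.const_add 1).sub he) ((hb.const_add 1).sub he)
    ((hc.const_add 1).sub he) ((hd.const_add 1).sub he) (he.const_sub 2) ((hf.const_add 1).sub he)
    ((hg.const_add 1).sub he) fun z => by
      simp only [Pi.sub_apply]
      linear_combination hbal z
  have B3 := differentiable_bilSum_vec (hf.sub hb) (hg.sub hb) ha ((ha.const_add 1).sub he)
    ((ha.const_add 1).sub hb) (((ha.const_add 1).add hc).sub he)
    (((ha.const_add 1).add hd).sub he) fun z => by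
      simp only [Pi.sub_apply, Pi.add_apply]
      linear_combination -hbal z
  have B4 := differentiable_bilSum_vec (hf.sub ha) (hg.sub ha) hb ((hb.const_add 1).sub he)
    ((hb.const_add 1).sub ha) (((hb.const_add 1).add hc).sub he)
    (((hb.const_add 1).add hd).sub he) fun z => by
      simp only [Pi.sub_apply, Pi.add_apply]
      linear_combination -hbal z
  simp only [Pi.sub_apply, Pi.add_apply] at B1 B2 B3 B4
  have Sa := S ha
  have Sb := S hb
  have Sc := S hc
  have Sd := S hd
  have Sae := S ((ha.const_add 1).sub he)
  have Sbe := S ((hb.const_add 1).sub he)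
  have Sce := S ((hc.const_add 1).sub he)
  have Sde := S ((hd.const_add 1).sub he)
  have Sfa := S (hf.sub ha)
  have Sfb := S (hf.sub hb)
  have Sga := S (hg.sub ha)
  have Sgb := S (hg.sub hb)
  exact ((((S ((ha.const_add 1).sub hb)).mul ((((G hc).mul (G hd)).mul
    (G ((hc.const_add 1).sub he))).mul (G ((hd.const_add 1).sub he)))).mul
    (((Sfb.mul Sgb).mul Sfa).mul Sga)).mul (((((Sae.mul Sbe).mul Sce).mul Sde).mul B1).sub
    ((((Sa.mul Sb).mul Sc).mul Sd).mul B2))).sub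
    ((((S he).mul ((((G (hf.sub hb)).mul (G (hg.sub hb))).mul (G (hf.sub ha))).mul
    (G (hg.sub ha)))).mul (((Sc.mul Sd).mul Sce).mul Sde)).mul
    (((((Sfa.mul Sga).mul Sb).mul Sbe).mul B3).sub ((((Sfb.mul Sgb).mul Sa).mul Sae).mul B4)))

theorem Sn_ne_zero_of_re {x : ℂ} (h0 : 0 < x.re) (h1 : x.re < 1) : Sn x ≠ 0 := fun h => by
  obtain ⟨n, rfl⟩ := Sn_eq_zero_iff.mp h
  rw [intCast_re] at h0 h1
  have h2 : 0 < n := by exact_mod_cast h0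
  have h3 : n < 1 := by exact_mod_cast h1
  omega

theorem transformDefect_eq_zero_of_near {a b c d e f g : ℂ} (hbal : e + f + g = a + b + c + d + 1)
    (ha : |a.re - 1 / 2| < 1 / 100) (hb : |b.re - 2 / 5| < 1 / 100)
    (hc : |c.re - 1 / 8| < 1 / 100) (hd : |d.re - 1 / 8| < 1 / 100)
    (he : |e.re - 3 / 4| < 1 / 100) (hf : |f.re - 7 / 10| < 1 / 100)
    (hg : |g.re - 7 / 10| < 1 / 100) : transformDefect a b c d e f g = 0 := by
  rw [abs_lt] at ha hb hc hd he hf hg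
  obtain ⟨ha1, ha2⟩ := ha
  obtain ⟨hb1, hb2⟩ := hb
  obtain ⟨hc1, hc2⟩ := hc
  obtain ⟨hd1, hd2⟩ := hd
  obtain ⟨he1, he2⟩ := he
  obtain ⟨hf1, hf2⟩ := hf
  obtain ⟨hg1, hg2⟩ := hg
  have hreg : TransformRegime a b c d e f g := by
    refine ⟨hbal, ?_, ?_, ?_, ?_, ?_, ?_, ?_, ?_, ?_, ?_, ?_, ?_, ?_, ?_, ?_, ?_, ?_, ?_⟩ <;>
    · try simp only [add_re, sub_re, one_re, re_ofNat]
      linarith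
  have hS : ∀ {x : ℂ}, 0 < x.re ∧ x.re < 1 → Sn x ≠ 0 := fun h => Sn_ne_zero_of_re h.1 h.2
  rw [transformDefect_eq (hS ?_) (hS ?_) (hS ?_) (hS ?_) (hS ?_) (hS ?_) (hS ?_) (hS ?_) (hS ?_)
    (hS ?_) (hS ?_) (hS ?_)]
  rotate_left
  iterate 12
    · try simp only [add_re, sub_re, one_re]
      constructor <;> linarith
  have h := hreg.Fstar_sub
  have hκ : Gamma (f + g - a - b) ≠ 0 := Gamma_ne_zero_of_re_pos hreg.κ_pos
  have hpi : (Real.pi : ℂ) ≠ 0 := ofReal_ne_zero.mpr Real.pi_ne_zero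
  refine mul_eq_zero_of_right _ (mul_left_cancel₀ (inv_ne_zero (mul_ne_zero hpi hκ)) ?_)
  rw [mul_inv]
  linear_combination h

theorem transformDefect_eq_zero {a b c d e f g : ℂ} (hbal : e + f + g = a + b + c + d + 1) :
    transformDefect a b c d e f g = 0 := by
  set ℓ : ℝ → ℂ → ℂ → ℂ := fun x y z => x + z * (y - x) with hℓ
  have hd : ∀ x y, Differentiable ℂ (ℓ x y) := fun x y => by fun_prop
  have hnear : ∀ x y, ∀ᶠ z in 𝓝 (0 : ℂ), |(ℓ x y z).re - x| < 1 / 100 := fun x y => by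
    have h : ContinuousAt (fun z => |(ℓ x y z).re - x|) 0 :=
      ((continuous_re.comp (hd x y).continuous).sub continuous_const).abs.continuousAt
    refine h.eventually_lt continuousAt_const ?_
    simp [hℓ]
  have hbal' : ∀ z, ℓ (3 / 4) e z + ℓ (7 / 10) f z + ℓ (7 / 10) g z =
      ℓ (1 / 2) a z + ℓ (2 / 5) b z + ℓ (1 / 8) c z + ℓ (1 / 8) d z + 1 := fun z => by
    simp only [hℓ]
    push_cast
    linear_combination z * hbal
  have han := (differentiable_transformDefect (hd (1 / 2) a) (hd (2 / 5) b) (hd (1 / 8) c)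
    (hd (1 / 8) d) (hd (3 / 4) e) (hd (7 / 10) f) (hd (7 / 10) g) hbal')
  have h0 := AnalyticOnNhd.eq_of_eventuallyEq (f := fun z => transformDefect (ℓ (1 / 2) a z)
    (ℓ (2 / 5) b z) (ℓ (1 / 8) c z) (ℓ (1 / 8) d z) (ℓ (3 / 4) e z) (ℓ (7 / 10) f z)
    (ℓ (7 / 10) g z)) (g := fun _ => 0) (z₀ := 0) (fun z _ => han.analyticAt z)
    (fun z _ => analyticAt_const) (by
      filter_upwards [hnear (1 / 2) a, hnear (2 / 5) b, hnear (1 / 8) c, hnear (1 / 8) d,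
        hnear (3 / 4) e, hnear (7 / 10) f, hnear (7 / 10) g] with z h1 h2 h3 h4 h5 h6 h7
      exact transformDefect_eq_zero_of_near (hbal' z) h1 h2 h3 h4 h5 h6 h7)
  simpa [hℓ] using congrFun h0 1

/-- The two-term transformation of `Lf`. -/
theorem Lf_transform {a b c d e f g : ℂ} (hbal : e + f + g = a + b + c + d + 1)
    (ha : Sn a ≠ 0) (hb : Sn b ≠ 0) (hc : Sn c ≠ 0)
    (hd : Sn d ≠ 0) (hae : Sn (1 + a - e) ≠ 0) (hbe : Sn (1 + b - e) ≠ 0)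
    (hce : Sn (1 + c - e) ≠ 0) (hde : Sn (1 + d - e) ≠ 0) (hfa : Sn (f - a) ≠ 0)
    (hfb : Sn (f - b) ≠ 0) (hga : Sn (g - a) ≠ 0) (hgb : Sn (g - b) ≠ 0) (he : Sn e ≠ 0)
    (hab : Sn (1 + a - b) ≠ 0) :
    Lf a b c d e f g =
      Lf (f - b) (g - b) a (1 + a - e) (1 + a - b) (1 + a + c - e) (1 + a + d - e) := by
  have hpi : (Real.pi : ℂ) ≠ 0 := ofReal_ne_zero.mpr Real.pi_ne_zero
  have h := transformDefect_eq_zero hbal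
  have γ := fun {x : ℂ} (h : Sn x ≠ 0) => Gamma_ne_zero_of_Sn_ne_zero h
  rw [transformDefect_eq ha hb hc hd hae hbe hce hde hfa hfb hga hgb] at h
  replace h := (mul_eq_zero.mp h).resolve_left (by
    simp [ha, hb, hc, hd, hae, hbe, hce, hde, hfa, hfb, hga, hgb, γ hc, γ hd, γ hce, γ hde, γ hfa,
      γ hfb, γ hga, γ hgb, Real.pi_ne_zero])
  unfold Lf
  rw [show 1 + (f - b) - (1 + a - b) = f - a by ring, show 1 + (g - b) - (1 + a - b) = g - a by ring,
    show 1 + a - (1 + a - b) = b by ring, show 1 + (1 + a - e) - (1 + a - b) = 1 + b - e by ring,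
    show 2 - (1 + a - b) = 1 + b - a by ring,
    show 1 + (1 + a + c - e) - (1 + a - b) = 1 + b + c - e by ring,
    show 1 + (1 + a + d - e) - (1 + a - b) = 1 + b + d - e by ring]
  rw [div_eq_div_iff (by simp [*]) (by simp [*])]
  linear_combination (Gamma a * Gamma b * Gamma (1 + a - e) * Gamma (1 + b - e)) * h

theorem Fstar_swap (a b c d e f g : ℂ) : Fstar a b c d e f g = Fstar b a c d e f g :=
  tsum_congr fun k => by ring

theorem Fstar_swap_pairs (a b c d e f g : ℂ) : Fstar a b c d e f g = Fstar c d a b e g f :=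
  tsum_congr fun k => by ring

theorem Lf_swap (a b c d e f g : ℂ) : Lf a b c d e f g = Lf b a c d e f g := by
  rw [Lf, Lf, Fstar_swap, Fstar_swap (1 + a - e)]
  ring

theorem Lf_swap_pairs (a b c d e f g : ℂ) : Lf a b c d e f g = Lf c d a b e g f := by
  rw [Lf, Lf, Fstar_swap_pairs, Fstar_swap_pairs (1 + a - e)]
  ring

theorem Lf_reflect {a b c d e f g : ℂ} (hbal : e + f + g = a + b + c + d + 1)
    (ha : Sn a ≠ 0) (hb : Sn b ≠ 0) (hc : Sn c ≠ 0) (hd : Sn d ≠ 0) (he : Sn e ≠ 0)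
    (hea : Sn (e - a) ≠ 0) (heb : Sn (e - b) ≠ 0) (hec : Sn (e - c) ≠ 0) (hed : Sn (e - d) ≠ 0)
    (hfa : Sn (f - a) ≠ 0) (hfb : Sn (f - b) ≠ 0) (hfc : Sn (f - c) ≠ 0) (hfd : Sn (f - d) ≠ 0)
    (hga : Sn (g - a) ≠ 0) (hgb : Sn (g - b) ≠ 0) (hgc : Sn (g - c) ≠ 0) (hgd : Sn (g - d) ≠ 0)
    (hfg : Sn (f - g) ≠ 0) (hba : Sn (b - a) ≠ 0) :
    Lf (1 - a) (1 - b) (1 - c) (1 - d) (2 - e) (2 - f) (2 - g) =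
      Lf (1 + a - f) (1 + b - f) (1 + c - f) (1 + d - f) (1 + g - f) (2 - f) (1 + e - f) := by
  have h1 : ∀ {x y : ℂ}, Sn x ≠ 0 → y = 1 - x → Sn y ≠ 0 := fun {x y} hx hy => by
    rwa [hy, Sn_one_sub]
  have h2 : ∀ {x y : ℂ}, Sn x ≠ 0 → y = x → Sn y ≠ 0 := fun {x y} hx hy => by rwa [hy]
  have h3 : ∀ {x y : ℂ}, Sn x ≠ 0 → y = 2 - x → Sn y ≠ 0 := fun {x y} hx hy => by
    have := Sn_one_sub (1 - (2 - x))
    rw [hy, ← Sn_one_sub, show 1 - (2 - x) = -(1 - x) by ring, Sn_neg, Sn_one_sub]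
    exact neg_ne_zero.mpr hx
  rw [Lf_swap, Lf_transform (by linear_combination -hbal) (h1 hb rfl) (h1 ha rfl) (h1 hc rfl)
    (h1 hd rfl) (h2 heb (by ring)) (h2 hea (by ring)) (h2 hec (by ring)) (h2 hed (by ring))
    (h1 hfb (by ring)) (h1 hfa (by ring)) (h1 hgb (by ring)) (h1 hga (by ring)) (h3 he rfl)
    (h1 hba (by ring)), Lf_transform (a := 1 + a - f) (by linear_combination hbal)
    (h1 hfa (by ring))
    (h1 hfb (by ring)) (h1 hfc (by ring)) (h1 hfd (by ring)) (h1 hga (by ring)) (h1 hgb (by ring))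
    (h1 hgc (by ring)) (h1 hgd (by ring)) (h1 ha (by ring)) (h1 hb (by ring)) (h2 hea (by ring))
    (h2 heb (by ring)) (h1 hfg (by ring)) (h1 hba (by ring)), Lf_swap_pairs]
  congr 1
  · ring
  · ring
  · ring
  · ring
  · ring
  · linear_combination hbal
  · linear_combination hbal

theorem bilShift_zero (α γ : Fin 4 → ℂ) : bilShift α γ 0 = bilSum α γ := by
  simp [bilShift]

theorem bilShift_neg_eq_reverse (a b c d e f g : ℂ) :
    bilShift ![a, b, c, d] ![1, e, f, g] (-a) =
      bilSum ![a, 1 + a - e, 1 + a - f, 1 + a - g] ![1, 1 + a - b, 1 + a - c, 1 + a - d] := by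
  rw [bilShift, bilSum_reverse]
  congr 1 <;> funext i <;> fin_cases i <;> simp <;> ring

theorem bilShift_swap (a b c d : ℂ) (γ : Fin 4 → ℂ) :
    bilShift ![a, b, c, d] γ = bilShift ![b, a, c, d] γ := by
  funext y
  refine tsum_congr fun n => ?_
  simp only [bilTerm, Fin.prod_univ_four, Matrix.cons_val, Matrix.cons_val_zero, Matrix.cons_val_one]
  ring

theorem bilShift_neg_lower_two (a b c d e f g : ℂ) :
    bilShift ![a, b, c, d] ![1, e, f, g] (-f) =
      bilSum ![1 + a - f, 1 + b - f, 1 + c - f, 1 + d - f] ![1, 1 + g - f, 2 - f, 1 + e - f] := by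
  rw [← bilShift_periodic]
  refine tsum_congr fun n => ?_
  simp only [bilTerm, Fin.prod_univ_four, Matrix.cons_val, Matrix.cons_val_zero, Matrix.cons_val_one]
  ring_nf

theorem bilShift_neg_lower_three (a b c d e f g : ℂ) :
    bilShift ![a, b, c, d] ![1, e, f, g] (-g) =
      bilSum ![1 + a - g, 1 + b - g, 1 + c - g, 1 + d - g] ![1, 1 + f - g, 2 - g, 1 + e - g] := by
  rw [← bilShift_periodic]
  refine tsum_congr fun n => ?_
  simp only [bilTerm, Fin.prod_univ_four, Matrix.cons_val, Matrix.cons_val_zero, Matrix.cons_val_one]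
  ring_nf

/-- Interpolation of a trigonometric polynomial of degree one at three points. -/
theorem trig_interpolation {h : ℂ → ℂ} {c₁ c₂ c₃ : ℂ} (hh : ∀ y, h y =
    c₁ * exp (-(2 * Real.pi * I * y)) + c₂ + c₃ * exp (2 * Real.pi * I * y)) (f g y : ℂ) :
    Sn f * Sn g * Sn (f - g) * h y = Sn (f - g) * Sn (y + f) * Sn (y + g) * h 0 -
      Sn f * Sn y * Sn (y + f) * h (-g) + Sn g * Sn y * Sn (y + g) * h (-f) := by
  have hS : ∀ x, Sn x = (exp (-(Real.pi * I * x)) - exp (Real.pi * I * x)) * I / 2 := fun x => by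
    rw [Sn, sin, show -(Real.pi * x) * I = -(Real.pi * I * x) by ring,
      show Real.pi * x * I = Real.pi * I * x by ring]
  have hh' : ∀ x, h x = c₁ * exp (-(Real.pi * I * x)) ^ 2 + c₂ +
      c₃ * exp (Real.pi * I * x) ^ 2 := fun x => by
    rw [hh, ← exp_nat_mul, ← exp_nat_mul]
    congr 3
    · push_cast; ring_nf
    · push_cast; ring_nf
  simp only [hh', hS, mul_add, mul_sub, mul_neg, neg_neg, neg_add, neg_sub, exp_add, exp_sub,
    exp_neg, mul_zero, exp_zero]
  have h1 := exp_ne_zero (Real.pi * I * f)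
  have h2 := exp_ne_zero (Real.pi * I * g)
  have h3 := exp_ne_zero (Real.pi * I * y)
  generalize exp (Real.pi * I * f) = F at *
  generalize exp (Real.pi * I * g) = G at *
  generalize exp (Real.pi * I * y) = Y at *
  field_simp
  ring

theorem Sn_mul_sub_mul (a b g : ℂ) :
    Sn (g - b) * Sn a - Sn (g - a) * Sn b = -(Sn g * Sn (b - a)) := by
  simp only [Sn_sub]
  ring

theorem Sn_mul_sub_mul_sub (a b e g : ℂ) :
    Sn (g - b) * Sn (e - b) - Sn (g - a) * Sn (e - a) = -(Sn (g + e - a - b) * Sn (b - a)) := by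
  simp only [Sn, mul_sub, mul_add, sin_sub, sin_add, cos_sub, cos_add]
  have ha := sin_sq_add_cos_sq (Real.pi * a)
  have hb := sin_sq_add_cos_sq (Real.pi * b)
  generalize sin (Real.pi * a) = sa at *
  generalize cos (Real.pi * a) = ca at *
  generalize sin (Real.pi * b) = sb at *
  generalize cos (Real.pi * b) = cb at *
  generalize sin (Real.pi * g) = sg at *
  generalize cos (Real.pi * g) = cg at *
  generalize sin (Real.pi * e) = se at *
  generalize cos (Real.pi * e) = ce at *
  grind

theorem Sn_balance {a b c d e f g : ℂ} (hbal : e + f + g = a + b + c + d + 1) :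
    Sn (g - b) * (Sn a * Sn c * Sn d + Sn (e - b) * Sn f * Sn g) -
      Sn (g - a) * (Sn b * Sn c * Sn d + Sn (e - a) * Sn f * Sn g) +
        Sn (b - a) * Sn (f - c) * Sn (f - d) * Sn g = 0 := by
  have h1 := Sn_mul_sub_mul a b g
  have h2 := Sn_mul_sub_mul_sub a b e g
  rw [show g + e - a - b = 1 - (f - c - d) by linear_combination hbal, Sn_one_sub] at h2
  have h3 := Sn_sub_mul_Sn_sub_sub c d f
  linear_combination Sn c * Sn d * h1 + Sn f * Sn g * h2 + Sn g * Sn (b - a) * h3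

theorem Kf_eq {a b c d e f g : ℂ} (ha : Sn a ≠ 0) (hb : Sn b ≠ 0) (hc : Sn c ≠ 0) (hd : Sn d ≠ 0)
    (hea : Sn (e - a) ≠ 0) (hfa : Sn (f - a) ≠ 0) (hga : Sn (g - a) ≠ 0) :
    Af (1 - a) (e - a) (f - a) (g - a) * Kf a b c d e f g =
      Af a b c d * (Sn (e - a) * Sn (f - a) * Sn (g - a) *
        bilShift ![a, b, c, d] ![1, e, f, g] 0 / (Sn a * Sn b * Sn c * Sn d) +
          bilShift ![a, b, c, d] ![1, e, f, g] (-a) / Sn a) := by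
  have hpi : (Real.pi : ℂ) ≠ 0 := ofReal_ne_zero.mpr Real.pi_ne_zero
  have s : ∀ x, Sn (1 + a - x) = Sn (x - a) := fun x => by
    rw [← Sn_one_sub, show 1 - (1 + a - x) = x - a by ring]
  rw [Kf, Fstar_eq_bilSum ha hb hc hd, Fstar_eq_bilSum ha (by rwa [s]) (by rwa [s]) (by rwa [s]),
    ← bilShift_zero, ← bilShift_neg_eq_reverse, s, s, s, Af, Af]
  have r1 := inv_Gamma_mul_inv_Gamma_one_sub a
  have r : ∀ x, (Gamma (x - a))⁻¹ * (Gamma (1 + a - x))⁻¹ = Sn (x - a) / Real.pi := fun x => by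
    rw [← inv_Gamma_mul_inv_Gamma_one_sub, show 1 - (x - a) = 1 + a - x by ring]
  have r2 := r e
  have r3 := r f
  have r4 := r g
  generalize bilShift ![a, b, c, d] ![1, e, f, g] 0 = X
  generalize bilShift ![a, b, c, d] ![1, e, f, g] (-a) = Y
  simp only [div_eq_mul_inv, mul_inv, one_mul] at *
  calc _ = (Gamma a)⁻¹ * (Gamma b)⁻¹ * (Gamma c)⁻¹ * (Gamma d)⁻¹ * (Sn a)⁻¹ *
        ((Gamma a)⁻¹ * (Gamma (1 - a))⁻¹) * ((Gamma (e - a))⁻¹ * (Gamma (1 + a - e))⁻¹) *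
        ((Gamma (f - a))⁻¹ * (Gamma (1 + a - f))⁻¹) * ((Gamma (g - a))⁻¹ * (Gamma (1 + a - g))⁻¹) *
        (Real.pi ^ 4 * X * ((Sn a)⁻¹ * (Sn b)⁻¹ * (Sn c)⁻¹ * (Sn d)⁻¹) +
          Real.pi ^ 4 * Y * ((Sn a)⁻¹ * (Sn (e - a))⁻¹ * (Sn (f - a))⁻¹ * (Sn (g - a))⁻¹)) := by
        ring
    _ = _ := by
        rw [r1, r2, r3, r4]
        field_simp

theorem Lf_eq {a b c d e f g : ℂ} (hbal : e + f + g = a + b + c + d + 1)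
    (ha : Sn a ≠ 0) (hb : Sn b ≠ 0) (hc : Sn c ≠ 0) (hd : Sn d ≠ 0) (he : Sn e ≠ 0)
    (hea : Sn (e - a) ≠ 0) (heb : Sn (e - b) ≠ 0) (hec : Sn (e - c) ≠ 0) (hed : Sn (e - d) ≠ 0)
    (hfa : Sn (f - a) ≠ 0) (hfb : Sn (f - b) ≠ 0) (hfc : Sn (f - c) ≠ 0) (hfd : Sn (f - d) ≠ 0)
    (hga : Sn (g - a) ≠ 0) (hgb : Sn (g - b) ≠ 0) (hgc : Sn (g - c) ≠ 0) (hgd : Sn (g - d) ≠ 0)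
    (hfg : Sn (f - g) ≠ 0) (hba : Sn (b - a) ≠ 0) :
    Af (f - a) (f - b) (f - c) (f - d) * Af (g - a) (g - b) (g - c) (g - d) *
        Lf (1 - a) (1 - b) (1 - c) (1 - d) (2 - e) (2 - f) (2 - g) =
      (Sn (g - a) * Sn (g - b) * Sn (g - c) * Sn (g - d) *
          bilShift ![a, b, c, d] ![1, e, f, g] (-f) -
        Sn (f - a) * Sn (f - b) * Sn (f - c) * Sn (f - d) *
          bilShift ![a, b, c, d] ![1, e, f, g] (-g)) / (Real.pi ^ 4 * Sn (f - g)) := by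
  have hpi : (Real.pi : ℂ) ≠ 0 := ofReal_ne_zero.mpr Real.pi_ne_zero
  have s : ∀ x y, Sn (1 + x - y) = Sn (y - x) := fun x y => by
    rw [← Sn_one_sub, show 1 - (1 + x - y) = y - x by ring]
  have s' : ∀ {x y}, Sn (y - x) ≠ 0 → Sn (1 + x - y) ≠ 0 := fun {x y} h => by rwa [s]
  rw [Lf_reflect hbal ha hb hc hd he hea heb hec hed hfa hfb hfc hfd hga hgb hgc hgd hfg hba, Lf]
  have e1 : ∀ x, 1 + (1 + x - f) - (1 + g - f) = 1 + x - g := fun x => by ring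
  have e2 : 1 + (2 - f) - (1 + g - f) = 2 - g := by ring
  have e3 : 2 - (1 + g - f) = 1 + f - g := by ring
  simp only [e1, e2, e3]
  rw [Fstar_eq_bilSum (s' hfa) (s' hfb) (s' hfc) (s' hfd),
    Fstar_eq_bilSum (s' hga) (s' hgb) (s' hgc) (s' hgd), ← bilShift_neg_lower_two,
    ← bilShift_neg_lower_three]
  have r : ∀ x y, (Gamma (y - x))⁻¹ * (Gamma (1 + x - y))⁻¹ = Sn (y - x) / Real.pi := fun x y => by
    rw [← inv_Gamma_mul_inv_Gamma_one_sub, show 1 - (y - x) = 1 + x - y by ring]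
  simp only [s, Af]
  generalize bilShift ![a, b, c, d] ![1, e, f, g] (-f) = X
  generalize bilShift ![a, b, c, d] ![1, e, f, g] (-g) = Y
  simp only [div_eq_mul_inv, mul_inv, one_mul] at *
  calc _ = ((Gamma (f - a))⁻¹ * (Gamma (1 + a - f))⁻¹) * ((Gamma (f - b))⁻¹ * (Gamma (1 + b - f))⁻¹) *
        ((Gamma (f - c))⁻¹ * (Gamma (1 + c - f))⁻¹) * ((Gamma (f - d))⁻¹ * (Gamma (1 + d - f))⁻¹) *
        (((Gamma (g - a))⁻¹ * (Gamma (1 + a - g))⁻¹) * ((Gamma (g - b))⁻¹ * (Gamma (1 + b - g))⁻¹) *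
        ((Gamma (g - c))⁻¹ * (Gamma (1 + c - g))⁻¹) * ((Gamma (g - d))⁻¹ * (Gamma (1 + d - g))⁻¹)) *
        (Sn (f - g))⁻¹ *
        (Real.pi ^ 4 * X *
            ((Sn (f - a))⁻¹ * (Sn (f - b))⁻¹ * (Sn (f - c))⁻¹ * (Sn (f - d))⁻¹) -
          Real.pi ^ 4 * Y *
            ((Sn (g - a))⁻¹ * (Sn (g - b))⁻¹ * (Sn (g - c))⁻¹ * (Sn (g - d))⁻¹)) := by
        ring
    _ = _ := by
        simp only [r]
        field_simp

theorem orbit2_LKK_relation (a b c d e f g : ℂ)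
    (hsaal : e + f + g = a + b + c + d + 1)
    (hint : ∀ i : Fin 7, ∀ n : ℤ, ![a, b, c, d, e, f, g] i ≠ (n : ℂ))
    (hdiff : ∀ i j : Fin 7, i ≠ j → ∀ n : ℤ,
      ![a, b, c, d, e, f, g] i - ![a, b, c, d, e, f, g] j ≠ (n : ℂ)) :
    Af (1 - a) (e - a) (f - a) (g - a) * B4 b a c d e f g * Kf a b c d e f g -
      Af (1 - b) (e - b) (f - b) (g - b) * B4 a b c d e f g * Kf b a c d e f g -
      Sn (b - a) * Af (f - a) (f - b) (f - c) (f - d) * Af (g - a) (g - b) (g - c) (g - d) *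
        Af a b c d * Lf (1 - a) (1 - b) (1 - c) (1 - d) (2 - e) (2 - f) (2 - g) = 0 := by
  have hpi : (Real.pi : ℂ) ≠ 0 := ofReal_ne_zero.mpr Real.pi_ne_zero
  have nz : ∀ i : Fin 7, Sn (![a, b, c, d, e, f, g] i) ≠ 0 := fun i h =>
    (Sn_eq_zero_iff.mp h).elim (hint i)
  have nz2 : ∀ i j : Fin 7, i ≠ j →
      Sn (![a, b, c, d, e, f, g] i - ![a, b, c, d, e, f, g] j) ≠ 0 := fun i j hij h =>
    (Sn_eq_zero_iff.mp h).elim (hdiff i j hij)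
  have ha : Sn a ≠ 0 := nz 0
  have hb : Sn b ≠ 0 := nz 1
  have hc : Sn c ≠ 0 := nz 2
  have hd : Sn d ≠ 0 := nz 3
  have he : Sn e ≠ 0 := nz 4
  have hf : Sn f ≠ 0 := nz 5
  have hg : Sn g ≠ 0 := nz 6
  have hea : Sn (e - a) ≠ 0 := nz2 4 0 (by decide)
  have heb : Sn (e - b) ≠ 0 := nz2 4 1 (by decide)
  have hec : Sn (e - c) ≠ 0 := nz2 4 2 (by decide)
  have hed : Sn (e - d) ≠ 0 := nz2 4 3 (by decide)
  have hfa : Sn (f - a) ≠ 0 := nz2 5 0 (by decide)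
  have hfb : Sn (f - b) ≠ 0 := nz2 5 1 (by decide)
  have hfc : Sn (f - c) ≠ 0 := nz2 5 2 (by decide)
  have hfd : Sn (f - d) ≠ 0 := nz2 5 3 (by decide)
  have hga : Sn (g - a) ≠ 0 := nz2 6 0 (by decide)
  have hgb : Sn (g - b) ≠ 0 := nz2 6 1 (by decide)
  have hgc : Sn (g - c) ≠ 0 := nz2 6 2 (by decide)
  have hgd : Sn (g - d) ≠ 0 := nz2 6 3 (by decide)
  have hfg : Sn (f - g) ≠ 0 := nz2 5 6 (by decide)
  have hba : Sn (b - a) ≠ 0 := nz2 1 0 (by decide)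
  have hKa := Kf_eq (b := b) (c := c) (d := d) ha hb hc hd hea hfa hga
  have hKb := Kf_eq (b := a) (c := c) (d := d) hb ha hc hd heb hfb hgb
  rw [← bilShift_swap a b c d, show Af b a c d = Af a b c d by simp only [Af, mul_comm (Gamma b)]]
    at hKb
  have hL := Lf_eq hsaal ha hb hc hd he hea heb hec hed hfa hfb hfc hfd hga hgb hgc hgd hfg hba
  obtain ⟨c₁, c₂, c₃, hΨ⟩ := exists_bilShift_eq (α := ![a, b, c, d]) (γ := ![1, e, f, g]) (by
    simp only [Fin.sum_univ_four, Matrix.cons_val]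
    linear_combination hsaal)
  have hIa := trig_interpolation hΨ f g (-a)
  have hIb := trig_interpolation hΨ f g (-b)
  rw [Sn_neg, neg_add_eq_sub, neg_add_eq_sub] at hIa hIb
  have hg' := Sn_balance hsaal
  have hf' := Sn_balance (show e + g + f = a + b + c + d + 1 by linear_combination hsaal)
  generalize bilShift ![a, b, c, d] ![1, e, f, g] 0 = X at *
  generalize bilShift ![a, b, c, d] ![1, e, f, g] (-a) = Ya at *
  generalize bilShift ![a, b, c, d] ![1, e, f, g] (-b) = Yb at *
  generalize bilShift ![a, b, c, d] ![1, e, f, g] (-f) = Yf at *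
  generalize bilShift ![a, b, c, d] ![1, e, f, g] (-g) = Yg at *
  calc _ = B4 b a c d e f g * (Af (1 - a) (e - a) (f - a) (g - a) * Kf a b c d e f g) -
        B4 a b c d e f g * (Af (1 - b) (e - b) (f - b) (g - b) * Kf b a c d e f g) -
        Sn (b - a) * Af a b c d * (Af (f - a) (f - b) (f - c) (f - d) *
          Af (g - a) (g - b) (g - c) (g - d) *
          Lf (1 - a) (1 - b) (1 - c) (1 - d) (2 - e) (2 - f) (2 - g)) := by ring
    _ = Af a b c d / Real.pi ^ 4 / (Sn a * Sn b * Sn c * Sn d * Sn (f - g)) * (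
        (Sn (f - b) * Sn (g - b) * (Sn a * Sn c * Sn d + Sn (e - b) * Sn f * Sn g)) *
          (Sn (e - a) * Sn (f - a) * Sn (g - a) * X + Sn b * Sn c * Sn d * Ya) * Sn (f - g) -
        (Sn (f - a) * Sn (g - a) * (Sn b * Sn c * Sn d + Sn (e - a) * Sn f * Sn g)) *
          (Sn (e - b) * Sn (f - b) * Sn (g - b) * X + Sn a * Sn c * Sn d * Yb) * Sn (f - g) -
        Sn (b - a) * (Sn a * Sn b * Sn c * Sn d) *
          (Sn (g - a) * Sn (g - b) * Sn (g - c) * Sn (g - d) * Yf -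
            Sn (f - a) * Sn (f - b) * Sn (f - c) * Sn (f - d) * Yg)) := by
        rw [hKa, hKb, hL, B4, B4]
        field_simp
    _ = 0 := by
        refine mul_eq_zero_of_right _ (mul_left_cancel₀ (mul_ne_zero hf hg) ?_)
        linear_combination
          (Sn (f - b) * Sn (g - b) * (Sn a * Sn c * Sn d + Sn (e - b) * Sn f * Sn g) *
            (Sn b * Sn c * Sn d)) * hIa -
          (Sn (f - a) * Sn (g - a) * (Sn b * Sn c * Sn d + Sn (e - a) * Sn f * Sn g) *
            (Sn a * Sn c * Sn d)) * hIb +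
          (Sn a * Sn b * Sn c * Sn d * Sn f * Sn (f - a) * Sn (f - b) * Yg) * hg' -
          (Sn a * Sn b * Sn c * Sn d * Sn g * Sn (g - a) * Sn (g - b) * Yf) * hf'
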